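/- arXiv:2007.08358 — 2 statements merged into one kernel-verified Lean document; each statement's English description precedes it below -/
import Mathlib

section
/- For every prime p, every prime ℓ dividing τ(p⁴) satisfies ℓ = p, or ℓ = 5, or ℓ ≡ 1 (mod 5), or ℓ ≡ 4 (mod 5). -/
/-- The Ramanujan tau function: `τ(n)` is the coefficient of `qⁿ` in
`q ∏_{i≥1} (1 - qⁱ)²⁴`. Since factors with `i > n` do not affect the
coefficient of `qⁿ`, it suffices to truncate the product at `i = n`. -/
noncomputable def ramanujanTau (n : ℕ) : ℤ :=
  (Polynomial.X * ∏ i ∈ Finset.range n, (1 - Polynomial.X ^ (i + 1)) ^ 24 :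
    Polynomial ℤ).coeff n

noncomputable section

open UpperHalfPlane hiding I
open Filter Topology MatrixGroups ModularForm

local notation "𝕢" => Function.Periodic.qParam

/-- The `N`-th truncation of the product `q ∏ (1 - qⁱ)²⁴`. -/
def truncatedDelta (R : Type*) [CommRing R] (N : ℕ) : Polynomial R :=
  Polynomial.X * ∏ i ∈ Finset.range N, (1 - Polynomial.X ^ (i + 1)) ^ 24

lemma truncatedDelta_map {R S : Type*} [CommRing R] [CommRing S] (f : R →+* S) (N : ℕ) :
    (truncatedDelta R N).map f = truncatedDelta S N := by
  simp [truncatedDelta, Polynomial.map_prod]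

lemma coeff_mul_one_sub_X_pow_pow {R : Type*} [CommRing R] (P : Polynomial R) {n m : ℕ}
    (h : n < m) (k : ℕ) : (P * (1 - Polynomial.X ^ m) ^ k).coeff n = P.coeff n := by
  induction k with
  | zero => simp
  | succ k ih =>
    rw [pow_succ, ← mul_assoc, mul_sub, mul_one, Polynomial.coeff_sub,
      Polynomial.coeff_mul_X_pow', if_neg h.not_ge, sub_zero, ih]

lemma truncatedDelta_coeff {R : Type*} [CommRing R] {n N : ℕ} (h : n ≤ N) :
    (truncatedDelta R N).coeff n = (truncatedDelta R n).coeff n := by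
  induction N, h using Nat.le_induction with
  | base => rfl
  | succ N hN ih =>
    rw [← ih, truncatedDelta, Finset.prod_range_succ, ← mul_assoc,
      coeff_mul_one_sub_X_pow_pow _ (by lia), truncatedDelta]

lemma Polynomial.iteratedDeriv_eval_zero (P : Polynomial ℂ) (n : ℕ) :
    iteratedDeriv n (fun q ↦ P.eval q) 0 = n.factorial * P.coeff n := by
  have key (m : ℕ) : iteratedDeriv m (fun q ↦ P.eval q) =
      fun q ↦ (Polynomial.derivative^[m] P).eval q := by
    induction m with
    | zero => simp
    | succ m ih =>
      rw [iteratedDeriv_succ, ih, Function.iterate_succ_apply']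
      ext q
      exact Polynomial.deriv _
  simp_rw [key]
  rw [← Polynomial.coeff_zero_eq_eval_zero, Polynomial.coeff_iterate_derivative]
  simp [Nat.descFactorial_self]

lemma TendstoLocallyUniformlyOn.iteratedDeriv {F : ℕ → ℂ → ℂ} {f : ℂ → ℂ} {U : Set ℂ}
    (hU : IsOpen U) (hf : TendstoLocallyUniformlyOn F f atTop U)
    (hF : ∀ n, DifferentiableOn ℂ (F n) U) (m : ℕ) :
    TendstoLocallyUniformlyOn (fun n ↦ iteratedDeriv m (F n)) (iteratedDeriv m f) atTop U := by
  induction m with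
  | zero => simpa using hf
  | succ m ih =>
    simp only [iteratedDeriv_succ]
    refine ih.deriv (.of_forall fun n ↦ ?_) hU
    rw [iteratedDeriv_eq_iterate]
    exact ((hF n).analyticOnNhd hU |>.iterated_deriv m).differentiableOn

lemma tendstoLocallyUniformlyOn_truncatedDelta :
    TendstoLocallyUniformlyOn (fun N q ↦ (truncatedDelta ℂ N).eval q)
      (cuspFunction 1 discriminant) atTop (Metric.ball 0 1) := by
  have h1 : TendstoLocallyUniformlyOn (fun N (q : ℂ) ↦ ∏ i ∈ Finset.range N, (1 - q ^ (i + 1)))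
      (fun q ↦ ∏' i, (1 - q ^ (i + 1))) atTop (Metric.ball 0 1) := by
    have := multipliableLocallyUniformlyOn_one_sub_pow.hasProdLocallyUniformlyOn
    intro u hu x hx
    obtain ⟨t, ht, h⟩ := hasProdLocallyUniformlyOn_iff_tendstoLocallyUniformlyOn.mp this u hu x hx
    refine ⟨t, ht, (tendsto_finset_range.eventually h).mono ?_⟩
    intro N hN
    simpa using hN
  have hdiff := differentiableOn_tprod_one_sub_pow.continuousOn
  have hconst (f : ℂ → ℂ) :
      TendstoLocallyUniformlyOn (fun (_ : ℕ) ↦ f) f atTop (Metric.ball 0 1) :=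
    fun u hu x hx ↦ ⟨_, self_mem_nhdsWithin, .of_forall fun _ _ _ ↦ refl_mem_uniformity hu⟩
  have h2 (k : ℕ) : TendstoLocallyUniformlyOn
      (fun N (q : ℂ) ↦ (∏ i ∈ Finset.range N, (1 - q ^ (i + 1))) ^ k)
      (fun q ↦ (∏' i, (1 - q ^ (i + 1))) ^ k) atTop (Metric.ball 0 1) := by
    induction k with
    | zero => simpa using hconst fun _ ↦ 1
    | succ k ih => simp only [pow_succ _ k]; exact ih.fun_mul₀ h1 (hdiff.pow k) hdiff
  refine (((hconst id).mul₀ (h2 24) continuousOn_id (hdiff.pow 24)).congr fun N q _ ↦ ?_).congr_right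
    fun q hq ↦ ?_
  · simp [truncatedDelta, Polynomial.eval_prod, Finset.prod_pow]
  · simp [discriminant_cuspFunction_eqOn hq,
      (multipliable_one_sub_pow (mem_ball_zero_iff.mp hq)).tprod_pow]

theorem discriminant_qExpansion_coeff (n : ℕ) :
    (qExpansion 1 discriminant).coeff n = ramanujanTau n := by
  have h := (tendstoLocallyUniformlyOn_truncatedDelta.iteratedDeriv Metric.isOpen_ball
    (fun N ↦ (Polynomial.differentiable _).differentiableOn) n).tendsto_at
      (Metric.mem_ball_self one_pos)
  simp_rw [Polynomial.iteratedDeriv_eval_zero] at h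
  have hlim : (n.factorial * (truncatedDelta ℂ n).coeff n : ℂ) =
      iteratedDeriv n (cuspFunction 1 discriminant) 0 :=
    tendsto_nhds_unique (tendsto_atTop_of_eventually_const (i₀ := n)
      fun N hN ↦ by rw [truncatedDelta_coeff hN]) h
  rw [qExpansion_coeff, ← hlim, inv_mul_cancel_left₀ (mod_cast n.factorial_ne_zero),
    ← truncatedDelta_map (Int.castRingHom ℂ), Polynomial.coeff_map]
  rfl

/-- The integral matrix with rows `(p, 0)` and `(0, 1)`. -/
def heckeDiag (p : ℕ) [NeZero p] : GL (Fin 2) ℝ :=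
  .mkOfDetNeZero !![(p : ℝ), 0; 0, 1] (by simp [Matrix.det_fin_two, NeZero.ne p])

/-- The integral matrix with rows `(1, b)` and `(0, p)`. -/
def heckeUpper (p : ℕ) [NeZero p] (b : ℤ) : GL (Fin 2) ℝ :=
  .mkOfDetNeZero !![1, (b : ℝ); 0, p] (by simp [Matrix.det_fin_two, NeZero.ne p])

@[simp]
lemma coe_heckeDiag (p : ℕ) [NeZero p] : (heckeDiag p).val = !![(p : ℝ), 0; 0, 1] := rfl

@[simp]
lemma coe_heckeUpper (p : ℕ) [NeZero p] (b : ℤ) :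
    (heckeUpper p b).val = !![1, (b : ℝ); 0, p] := rfl

/-- The Hecke operator `T_p` in weight `k`. -/
def heckeOperator (k : ℤ) (p : ℕ) [NeZero p] (f : ℍ → ℂ) : ℍ → ℂ :=
  f ∣[k] heckeDiag p + ∑ b : ZMod p, f ∣[k] heckeUpper p b.val

section
variable {p : ℕ} [NeZero p] {k : ℤ} {f : ℍ → ℂ}

lemma slash_slash_SL_of_mul_eq (hf : ∀ γ : SL(2, ℤ), f ∣[k] γ = f) {A B : GL (Fin 2) ℝ}
    {γ γ' : SL(2, ℤ)}
    (h : A.val * γ.val.map (Int.cast : ℤ → ℝ) = γ'.val.map (Int.cast : ℤ → ℝ) * B.val) :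
    (f ∣[k] A) ∣[k] γ = f ∣[k] B := by
  have h' : A * (γ : GL (Fin 2) ℝ) = (γ' : GL (Fin 2) ℝ) * B := Units.ext h
  rw [SL_slash, ← SlashAction.slash_mul, h', SlashAction.slash_mul, ← SL_slash, hf]

lemma slash_heckeUpper_eq_of_cast_eq (hf : ∀ γ : SL(2, ℤ), f ∣[k] γ = f) {b c : ℤ}
    (h : (b : ZMod p) = c) : f ∣[k] heckeUpper p b = f ∣[k] heckeUpper p c := by
  obtain ⟨m, hm⟩ := (ZMod.intCast_eq_intCast_iff_dvd_sub _ _ _).mp h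
  have hm' : (c : ℝ) = b + p * m := by exact_mod_cast (by lia : c = b + p * m)
  rw [← SlashAction.slash_one (G := SL(2, ℤ)) k (f ∣[k] heckeUpper p b)]
  refine slash_slash_SL_of_mul_eq (γ := 1) hf (γ' := ModularGroup.T ^ (-m)) ?_
  rw [ModularGroup.coe_T_zpow]
  ext i j
  simp only [Matrix.mul_apply, Fin.sum_univ_two]
  fin_cases i <;> fin_cases j <;> simp [hm', mul_comm]

lemma slash_heckeUpper_T (hf : ∀ γ : SL(2, ℤ), f ∣[k] γ = f) (b : ℤ) :
    (f ∣[k] heckeUpper p b) ∣[k] ModularGroup.T = f ∣[k] heckeUpper p (b + 1) := by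
  refine slash_slash_SL_of_mul_eq hf (γ' := 1) ?_
  ext i j
  simp only [Matrix.mul_apply, Fin.sum_univ_two]
  fin_cases i <;> fin_cases j <;> simp [ModularGroup.coe_T, add_comm]

lemma slash_heckeDiag_T (hf : ∀ γ : SL(2, ℤ), f ∣[k] γ = f) :
    (f ∣[k] heckeDiag p) ∣[k] ModularGroup.T = f ∣[k] heckeDiag p := by
  refine slash_slash_SL_of_mul_eq hf (γ' := ModularGroup.T ^ (p : ℤ)) ?_
  rw [ModularGroup.coe_T_zpow]
  ext i j
  simp only [Matrix.mul_apply, Fin.sum_univ_two]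
  fin_cases i <;> fin_cases j <;> simp [ModularGroup.coe_T]

lemma slash_heckeDiag_S (hf : ∀ γ : SL(2, ℤ), f ∣[k] γ = f) :
    (f ∣[k] heckeDiag p) ∣[k] ModularGroup.S = f ∣[k] heckeUpper p 0 := by
  refine slash_slash_SL_of_mul_eq hf (γ' := ModularGroup.S) ?_
  ext i j
  simp only [Matrix.mul_apply, Fin.sum_univ_two]
  fin_cases i <;> fin_cases j <;> simp [ModularGroup.coe_S]

lemma slash_heckeUpper_zero_S (hf : ∀ γ : SL(2, ℤ), f ∣[k] γ = f) :
    (f ∣[k] heckeUpper p 0) ∣[k] ModularGroup.S = f ∣[k] heckeDiag p := by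
  refine slash_slash_SL_of_mul_eq hf (γ' := ModularGroup.S) ?_
  ext i j
  simp only [Matrix.mul_apply, Fin.sum_univ_two]
  fin_cases i <;> fin_cases j <;> simp [ModularGroup.coe_S]

lemma slash_heckeUpper_S (hf : ∀ γ : SL(2, ℤ), f ∣[k] γ = f) {b c : ℤ}
    (h : (b * c : ZMod p) = -1) :
    (f ∣[k] heckeUpper p b) ∣[k] ModularGroup.S = f ∣[k] heckeUpper p c := by
  obtain ⟨m, hm⟩ : (p : ℤ) ∣ 1 + b * c := by
    rw [← ZMod.intCast_zmod_eq_zero_iff_dvd]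
    push_cast
    rw [h, add_neg_cancel]
  have hm' : 1 + (b : ℝ) * c = p * m := mod_cast hm
  refine slash_slash_SL_of_mul_eq hf
    (γ' := ⟨!![b, -m; p, -c], by rw [Matrix.det_fin_two_of]; linarith⟩) ?_
  ext i j
  simp only [Matrix.mul_apply, Fin.sum_univ_two]
  fin_cases i <;> fin_cases j <;> simp [ModularGroup.coe_S] <;> linarith
end

theorem heckeOperator_slash_SL {p : ℕ} [Fact p.Prime] {k : ℤ} {f : ℍ → ℂ}
    (hf : ∀ γ : SL(2, ℤ), f ∣[k] γ = f) (γ : SL(2, ℤ)) :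
    heckeOperator k p f ∣[k] γ = heckeOperator k p f := by
  refine SlashInvariantForm.slash_action_generators_SL2Z ?_ ?_ γ <;>
    simp only [heckeOperator, SlashAction.add_slash, SlashAction.sum_slash]
  · rw [slash_heckeDiag_S hf, ← Equiv.sum_comp ((Equiv.inv (ZMod p)).trans (Equiv.neg _)),
      Fintype.sum_eq_add_sum_compl (0 : ZMod p), Fintype.sum_eq_add_sum_compl (0 : ZMod p),
      ← add_assoc, ← add_assoc]
    congr 1
    · simp [slash_heckeUpper_zero_S hf, add_comm]
    · refine Finset.sum_congr rfl fun b hb ↦ slash_heckeUpper_S hf ?_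
      have hb0 : b ≠ 0 := by simpa using hb
      simp [hb0]
  · rw [slash_heckeDiag_T hf, ← Equiv.sum_comp (Equiv.subRight (1 : ZMod p))]
    congr 1
    refine Finset.sum_congr rfl fun b _ ↦ ?_
    rw [slash_heckeUpper_T hf]
    exact slash_heckeUpper_eq_of_cast_eq hf (by simp)

lemma qParam_natCast_mul (p : ℕ) (z : ℂ) : 𝕢 1 (p * z) = 𝕢 1 z ^ p := by
  rw [Function.Periodic.qParam, Function.Periodic.qParam, ← Complex.exp_nat_mul]
  congr 1
  ring

variable (p : ℕ) [NeZero p] (k : ℤ) (f : ℍ → ℂ)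

lemma heckeDiag_smul_coe (z : ℍ) : ((heckeDiag p • z : ℍ) : ℂ) = p * z := by
  rw [coe_smul_of_det_pos (by simp [heckeDiag, Matrix.det_fin_two, NeZero.pos p])]
  simp [heckeDiag, num, denom]

lemma heckeUpper_smul_coe (b : ℤ) (z : ℍ) : ((heckeUpper p b • z : ℍ) : ℂ) = (z + b) / p := by
  rw [coe_smul_of_det_pos (by simp [heckeUpper, Matrix.det_fin_two, NeZero.pos p])]
  simp [heckeUpper, num, denom]

lemma slash_heckeDiag_apply (z : ℍ) :
    (f ∣[k] heckeDiag p) z = p ^ (k - 1) * f (heckeDiag p • z) := by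
  rw [slash_apply]
  simp [heckeDiag, σ, denom, NeZero.pos p, mul_comm]

lemma slash_heckeUpper_apply (b : ℤ) (z : ℍ) :
    (f ∣[k] heckeUpper p b) z = (p : ℂ)⁻¹ * f (heckeUpper p b • z) := by
  have : (p : ℂ) ≠ 0 := NeZero.ne _
  rw [slash_apply]
  simp [heckeUpper, σ, denom, NeZero.pos p, mul_comm]
  rw [← mul_assoc, zpow_sub_one₀ this, inv_mul_cancel_left₀ (zpow_ne_zero _ this)]

lemma UpperHalfPlane.IsZeroAtImInfty.heckeOperator {f : ℍ → ℂ} (hf : IsZeroAtImInfty f) :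
    IsZeroAtImInfty (heckeOperator k p f) := by
  have hp : (0 : ℝ) < p := mod_cast NeZero.pos p
  have him : Tendsto UpperHalfPlane.im atImInfty atTop := tendsto_comap
  have h1 : Tendsto (fun z : ℍ ↦ f (heckeDiag p • z)) atImInfty (𝓝 0) := by
    refine hf.comp (tendsto_comap_iff.mpr ((him.const_mul_atTop hp).congr fun z ↦ ?_))
    simp [← coe_im, heckeDiag_smul_coe]
  have h2 (b : ℤ) : Tendsto (fun z : ℍ ↦ f (heckeUpper p b • z)) atImInfty (𝓝 0) := by
    refine hf.comp (tendsto_comap_iff.mpr ((him.atTop_div_const hp).congr fun z ↦ ?_))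
    simp [← coe_im, heckeUpper_smul_coe]
  have := (h1.const_mul ((p : ℂ) ^ (k - 1))).add
    (tendsto_finsetSum Finset.univ fun (b : ZMod p) _ ↦ (h2 b.val).const_mul (p : ℂ)⁻¹)
  refine Tendsto.congr (fun z ↦ ?_) (by simpa using this)
  simp [_root_.heckeOperator, slash_heckeDiag_apply, slash_heckeUpper_apply]

/-- The Hecke operator `T_p` on cusp forms of level one. -/
def CuspForm.hecke (p : ℕ) [Fact p.Prime] {k : ℤ} (f : CuspForm 𝒮ℒ k) : CuspForm 𝒮ℒ k where
  toFun := heckeOperator k p f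
  slash_action_eq' := by
    rintro _ ⟨γ, rfl⟩
    exact heckeOperator_slash_SL (fun γ ↦ f.slash_action_eq' _ ⟨γ, rfl⟩) γ
  holo' := by
    refine (f.holo'.slash k _).add (MDifferentiable.sum fun b _ ↦ f.holo'.slash k _)
  zero_at_cusps' hc := by
    rw [Subgroup.IsArithmetic.isCusp_iff_isCusp_SL2Z] at hc
    rw [OnePoint.isZeroAt_iff_forall_SL2Z hc]
    intro γ _
    change IsZeroAtImInfty (heckeOperator k p f ∣[k] γ)
    rw [heckeOperator_slash_SL (f := ⇑f) (fun γ ↦ f.slash_action_eq' _ ⟨γ, rfl⟩)]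
    exact (CuspFormClass.zero_at_infty f).heckeOperator p k

lemma qParam_add_div (z : ℂ) (b : ZMod p) :
    𝕢 1 ((z + (b.val : ℤ)) / p) = ZMod.stdAddChar b * 𝕢 1 (z / p) := by
  conv_rhs => rw [← ZMod.natCast_zmod_val b, ← Int.cast_natCast, ZMod.stdAddChar_coe]
  rw [Function.Periodic.qParam, Function.Periodic.qParam, ← Complex.exp_add]
  congr 1
  push_cast
  ring

lemma sum_stdAddChar_pow (m : ℕ) :
    ∑ b : ZMod p, ZMod.stdAddChar b ^ m = if p ∣ m then (p : ℂ) else 0 := by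
  simp_rw [← AddChar.map_nsmul_eq_pow, nsmul_eq_mul, mul_comm (m : ZMod p)]
  rw [AddChar.sum_mulShift _ (ZMod.isPrimitive_stdAddChar p)]
  simp [ZMod.natCast_eq_zero_iff]

lemma hasSum_ite_dvd_iff {g : ℕ → ℂ} {s : ℂ} :
    HasSum (fun n ↦ if p ∣ n then g n else 0) s ↔ HasSum (fun n ↦ g (p * n)) s := by
  rw [← (mul_right_injective₀ (NeZero.ne p)).hasSum_iff (f := fun n ↦ if p ∣ n then g n else 0)]
  · simp [Function.comp_def]
  · exact fun n hn ↦ if_neg fun ⟨m, hm⟩ ↦ hn ⟨m, hm.symm⟩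

/-- The action of `T_p` on Fourier coefficients. -/
theorem CuspForm.hecke_qExpansion_coeff (p : ℕ) [Fact p.Prime] {k : ℤ} (f : CuspForm 𝒮ℒ k)
    (n : ℕ) :
    (qExpansion 1 (f.hecke p)).coeff n = (qExpansion 1 f).coeff (p * n) +
      if p ∣ n then (p : ℂ) ^ (k - 1) * (qExpansion 1 f).coeff (n / p) else 0 := by
  have hp : (p : ℂ) ≠ 0 := NeZero.ne _
  refine (ModularFormClass.qExpansion_coeff_unique (Γ := 𝒮ℒ) (k := k) one_pos
    one_mem_strictPeriods_SL (c := fun n ↦ (qExpansion 1 f).coeff (p * n) +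
      if p ∣ n then (p : ℂ) ^ (k - 1) * (qExpansion 1 f).coeff (n / p) else 0) (fun z ↦ ?_) n).symm
  have hf (z : ℍ) := ModularForm.hasSum_qExpansion (Γ := 𝒮ℒ) f one_pos one_mem_strictPeriods_SL z
  have hdiag : HasSum (fun n ↦ if p ∣ n then
      (p : ℂ) ^ (k - 1) * ((qExpansion 1 f).coeff (n / p) * 𝕢 1 z ^ n) else 0)
      ((⇑f ∣[k] heckeDiag p) z) := by
    rw [slash_heckeDiag_apply, hasSum_ite_dvd_iff]
    refine ((hf (heckeDiag p • z)).mul_left ((p : ℂ) ^ (k - 1))).congr_fun fun n ↦ ?_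
    rw [heckeDiag_smul_coe, qParam_natCast_mul, ← pow_mul,
      Nat.mul_div_cancel_left _ (NeZero.pos p)]
  have hupper : HasSum (fun n ↦ (qExpansion 1 f).coeff (p * n) * 𝕢 1 z ^ n)
      (∑ b : ZMod p, (⇑f ∣[k] heckeUpper p b.val) z) := by
    have h := hasSum_sum (s := Finset.univ) fun (b : ZMod p) _ ↦
      (hf (heckeUpper p b.val • z)).mul_left (p : ℂ)⁻¹
    simp_rw [heckeUpper_smul_coe, qParam_add_div, mul_pow, mul_left_comm _ (_ ^ _) (_ ^ _),
      mul_left_comm _ (_ ^ _) (_ * _), ← Finset.sum_mul, sum_stdAddChar_pow, ite_mul, zero_mul,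
      hasSum_ite_dvd_iff, ← slash_heckeUpper_apply p k] at h
    refine h.congr_fun fun n ↦ ?_
    rw [pow_mul, ← qParam_natCast_mul p, mul_div_cancel₀ _ hp]
    field_simp
  have hz : (f.hecke p) z =
      (⇑f ∣[k] heckeDiag p) z + ∑ b : ZMod p, (⇑f ∣[k] heckeUpper p b.val) z := by
    change heckeOperator k p f z = _
    simp [heckeOperator]
  rw [hz, add_comm]
  refine (hupper.add hdiag).congr_fun fun n ↦ ?_
  split_ifs <;> simp [add_mul, mul_assoc]

lemma ramanujanTau_one : ramanujanTau 1 = 1 := by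
  have h := discriminant_qExpansion_coeff 1
  rw [discriminant_qExpansion_coeff_one] at h
  exact_mod_cast h.symm

/-- Mordell's theorem: `Δ` is an eigenform for `T_p`, with eigenvalue `τ(p)`. -/
theorem ramanujanTau_prime_mul {p : ℕ} (hp : p.Prime) (n : ℕ) :
    ramanujanTau (p * n) + (if p ∣ n then (p : ℤ) ^ 11 * ramanujanTau (n / p) else 0) =
      ramanujanTau p * ramanujanTau n := by
  have : Fact p.Prime := ⟨hp⟩
  obtain ⟨c, hc⟩ := CuspForm.exists_smul_discriminant_of_weight_eq_twelve
    (CuspForm.discriminant.hecke p)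
  have key (n : ℕ) : (ramanujanTau (p * n) +
      if p ∣ n then (p : ℂ) ^ 11 * ramanujanTau (n / p) else 0 : ℂ) = c * ramanujanTau n := by
    have h := CuspForm.hecke_qExpansion_coeff p CuspForm.discriminant n
    have hcoe : (c • CuspForm.discriminant : ℍ → ℂ) = CuspForm.discriminant.hecke p :=
      congrArg DFunLike.coe hc
    rw [← hcoe, ModularForm.qExpansion_smul one_pos one_mem_strictPeriods_SL c,
      PowerSeries.coeff_smul, smul_eq_mul] at h
    have hΔ (m : ℕ) : (qExpansion 1 CuspForm.discriminant).coeff m = ramanujanTau m :=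
      discriminant_qExpansion_coeff m
    simp only [hΔ] at h
    rw [h]
    norm_num
  have hcp : c = ramanujanTau p := by
    simpa [hp.one_lt.ne', ramanujanTau_one] using (key 1).symm
  have := key n
  rw [hcp] at this
  exact_mod_cast this

theorem ramanujanTau_prime_pow_add_two {p : ℕ} (hp : p.Prime) (k : ℕ) :
    ramanujanTau (p ^ (k + 2)) =
      ramanujanTau p * ramanujanTau (p ^ (k + 1)) - (p : ℤ) ^ 11 * ramanujanTau (p ^ k) := by
  have h := ramanujanTau_prime_mul hp (p ^ (k + 1))
  rw [if_pos (dvd_pow_self p k.succ_ne_zero), pow_succ p k, Nat.mul_div_cancel _ hp.pos] at h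
  rw [pow_succ p k, ← h, show p ^ (k + 2) = p * (p ^ k * p) by ring]
  ring

lemma ramanujanTau_prime_pow_four {p : ℕ} (hp : p.Prime) :
    ramanujanTau (p ^ 4) =
      ramanujanTau p ^ 4 - 3 * p ^ 11 * ramanujanTau p ^ 2 + (p : ℤ) ^ 22 := by
  have h0 := ramanujanTau_prime_pow_add_two hp 0
  have h1 := ramanujanTau_prime_pow_add_two hp 1
  have h2 := ramanujanTau_prime_pow_add_two hp 2
  norm_num [ramanujanTau_one] at h0 h1 h2
  rw [h2, h1, h0]
  ring

lemma mod_five_of_isSquare_five {ℓ : ℕ} (hℓ : ℓ.Prime) (h2 : ℓ ≠ 2) (h5 : ℓ ≠ 5)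
    (h : IsSquare (5 : ZMod ℓ)) : ℓ % 5 = 1 ∨ ℓ % 5 = 4 := by
  have key : ∀ a : ZMod 5, IsSquare a → a.val = 0 ∨ a.val = 1 ∨ a.val = 4 := by decide
  have : Fact ℓ.Prime := ⟨hℓ⟩
  have : Fact (Nat.Prime 5) := ⟨Nat.prime_five⟩
  have hsq : IsSquare (ℓ : ZMod 5) :=
    (ZMod.exists_sq_eq_prime_iff_of_mod_four_eq_one (p := 5) (by norm_num) h2).mpr
      (by simpa using h)
  have hne : ℓ % 5 ≠ 0 := fun h0 ↦
    h5 ((Nat.prime_dvd_prime_iff_eq Nat.prime_five hℓ).mp (Nat.dvd_of_mod_eq_zero h0)).symm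
  simpa [ZMod.val_natCast, hne] using key _ hsq

end

theorem prime_dvd_tau_pow_four (p : ℕ) (hp : p.Prime) (ℓ : ℕ) (hℓ : ℓ.Prime)
    (hdvd : (ℓ : ℤ) ∣ ramanujanTau (p ^ 4)) :
    ℓ = p ∨ ℓ = 5 ∨ ℓ % 5 = 1 ∨ ℓ % 5 = 4 := by
  by_contra! ⟨hℓp, h5, h1, h4⟩
  have : Fact ℓ.Prime := ⟨hℓ⟩
  have hp0 : (p : ZMod ℓ) ≠ 0 := by
    rw [Ne, ZMod.natCast_eq_zero_iff, Nat.prime_dvd_prime_iff_eq hℓ hp]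
    exact hℓp
  have h := (ZMod.intCast_zmod_eq_zero_iff_dvd _ ℓ).mpr hdvd
  rw [ramanujanTau_prime_pow_four hp] at h
  push_cast at h
  generalize (ramanujanTau p : ZMod ℓ) = t at h
  obtain rfl | h2 := eq_or_ne ℓ 2
  · revert h hp0
    generalize (p : ZMod 2) = x
    decide +revert
  · refine (mod_five_of_isSquare_five hℓ h2 h5
      ⟨(2 * t ^ 2 - 3 * p ^ 11) / p ^ 11, ?_⟩).elim h1 h4
    field_simp
    linear_combination -4 * h
end

section
/- Let (a, b) be one of the pairs (1, ±2), (4, ±1), (4, ±3), (11, ±4), (14, ±5), (6, ±5). For every n with 0 ≤ n ≤ 10^300, if a·uₙ + b·vₙ = x^{11} for some integer x, then x = 1 or x = −1. -/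
/-- The Fibonacci numbers as integers: `u₀ = 0`, `u₁ = 1`, `u_{n+2} = u_{n+1} + uₙ`. -/
def fibZ (n : ℕ) : ℤ := Nat.fib n

/-- The Lucas numbers: `v₀ = 2`, `v₁ = 1`, `v_{n+2} = v_{n+1} + vₙ`. -/
def lucasZ : ℕ → ℤ
  | 0 => 2
  | 1 => 1
  | n + 2 => lucasZ (n + 1) + lucasZ n

/-- The two-sided Fibonacci-type sequence with value `1` at `0` and value `c` at `1`. -/
def gibonacci (c n : ℤ) : ℤ := Int.fib (n - 1) + c * Int.fib n

theorem ne_zero_of_sq_eq_add_one {F : Type*} [Field F] {r : F} (hr : r ^ 2 = r + 1) :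
    r ≠ 0 ∧ 1 - r ≠ 0 := by
  constructor <;> rintro h
  · simp [h] at hr
  · obtain rfl : r = 1 := (sub_eq_zero.mp h).symm
    simp at hr

theorem binet_fib {F : Type*} [Field F] {r : F} (hr : r ^ 2 = r + 1) (n : ℤ) :
    (2 * r - 1) * (Int.fib n : F) = r ^ n - (1 - r) ^ n := by
  obtain ⟨h₀, h₁⟩ := ne_zero_of_sq_eq_add_one hr
  have key : ∀ k : ℤ, (2 * r - 1) * (Int.fib k : F) = r ^ k - (1 - r) ^ k ∧
      (2 * r - 1) * (Int.fib (k + 1) : F) = r ^ (k + 1) - (1 - r) ^ (k + 1) := by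
    intro k
    induction k using Int.induction_on with
    | zero => simp; ring
    | succ k ih =>
      refine ⟨ih.2, ?_⟩
      have h : ((k : ℤ) + 1 + 1) = k + 2 := by ring
      rw [h, Int.fib_add_two, zpow_add₀ h₀, zpow_add₀ h₁]
      obtain ⟨ih₁, ih₂⟩ := ih
      rw [zpow_add_one₀ h₀, zpow_add_one₀ h₁] at ih₂
      push_cast
      rw [mul_add, ih₁, ih₂]
      simp only [zpow_ofNat]
      linear_combination ((1 - r) ^ (k : ℤ) - r ^ (k : ℤ)) * hr
    | pred k ih =>
      obtain ⟨ih₁, ih₂⟩ := ih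
      have h : (-(k : ℤ) - 1 + 1) = -k := by ring
      rw [h]
      refine ⟨?_, ih₁⟩
      have h' := Int.fib_eq_fib_add_two_sub_fib_add_one (-(k : ℤ) - 1)
      rw [h, show -(k : ℤ) - 1 + 2 = -k + 1 by ring] at h'
      rw [h']
      push_cast
      rw [mul_sub, ih₁, ih₂, zpow_add_one₀ h₀, zpow_add_one₀ h₁, zpow_sub_one₀ h₀,
        zpow_sub_one₀ h₁]
      field_simp
      linear_combination (r ^ (-(k : ℤ)) * (1 - r) - (1 - r) ^ (-(k : ℤ)) * r) * hr
  exact (key n).1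

theorem binet_gibonacci {F : Type*} [Field F] {r : F} (hr : r ^ 2 = r + 1) (c n : ℤ) :
    (2 * r - 1) * (gibonacci c n : F) = (c + r - 1) * r ^ n + (r - c) * (1 - r) ^ n := by
  obtain ⟨h₀, h₁⟩ := ne_zero_of_sq_eq_add_one hr
  have h := binet_fib hr (n - 1)
  rw [zpow_sub_one₀ h₀, zpow_sub_one₀ h₁] at h
  have hi : r⁻¹ = r - 1 := inv_eq_of_mul_eq_one_right (by linear_combination hr)
  have hi' : (1 - r)⁻¹ = -r := inv_eq_of_mul_eq_one_right (by linear_combination hr)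
  rw [hi, hi'] at h
  rw [gibonacci]
  push_cast
  linear_combination h + (c : F) * binet_fib hr n

theorem pow_eq_of_gibonacci_eq_pow {F : Type*} [Field F] {r ε : F} (hr : r ^ 2 = r + 1)
    (hε : ε = 1 ∨ ε = -1) {M q s d e : ℕ} {c j : ℤ} {x : F} (h₁ : (r ^ M) ^ q = ε)
    (h₂ : ((1 - r) ^ M) ^ q = ε) (he : Even e) (hx : x ^ (d * e) = 0 ∨ x ^ (d * e) = 1)
    (h : (gibonacci c (M * (q * j + s)) : F) = x ^ d) :
    ((c + r - 1) * (r ^ M) ^ s + (r - c) * ((1 - r) ^ M) ^ s) ^ e = 0 ∨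
      ((c + r - 1) * (r ^ M) ^ s + (r - c) * ((1 - r) ^ M) ^ s) ^ e = (2 * r - 1) ^ e := by
  obtain ⟨h₀, h₀'⟩ := ne_zero_of_sq_eq_add_one hr
  have hb := binet_gibonacci hr c (M * (q * j + s))
  have aux : ∀ t : F, t ≠ 0 → (t ^ M) ^ q = ε → t ^ ((M : ℤ) * (q * j + s)) =
      ε ^ j * (t ^ M) ^ s := by
    intro t ht hte
    rw [zpow_mul, zpow_add₀ (by simp [ht]), zpow_mul]
    simp only [zpow_natCast]
    rw [hte]
  rw [aux r h₀ h₁, aux (1 - r) h₀' h₂, h] at hb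
  have hη : (ε ^ j) ^ e = 1 := by
    rcases hε with rfl | rfl
    · simp
    · rw [← zpow_natCast, ← zpow_mul, mul_comm, zpow_mul, zpow_natCast, he.neg_one_pow,
        one_zpow]
  have key : ((c + r - 1) * (r ^ M) ^ s + (r - c) * ((1 - r) ^ M) ^ s) ^ e =
      (2 * r - 1) ^ e * x ^ (d * e) := by
    rw [pow_mul, ← mul_pow, hb, ← one_mul (_ ^ e), ← hη, ← mul_pow]
    ring
  rcases hx with hx | hx <;> simp [key, hx]

/-- The product of the primes below `1000`. -/
def smallPrimesProduct : ℕ :=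
  19590340644999083431262508198206381046123972390589368223882605328968666316379870661851951648789482321596229559115436019149189529725215266728292282990852649023362731392404017939142010958261393634959471483757196721672243410067118516227661133135192488848989914892157188308679896875137439519338903968094905549750386407106033836586660683539201011635917900039904495065203299749542985993134669814805318474080581207891125910

theorem prime_of_gcd_smallPrimesProduct {p : ℕ} (h₁ : 1 < p) (h₂ : p < 1000000)
    (h : p.gcd smallPrimesProduct = 1) : p.Prime := by
  have small : ∀ d < 1000, 2 ≤ d → d.gcd smallPrimesProduct ≠ 1 := by decide +kernel
  by_contra hp
  have hsq := Nat.minFac_sq_le_self (by omega) hp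
  have hm := (Nat.minFac_prime (n := p) (by omega)).two_le
  refine small p.minFac (by nlinarith) hm (Nat.dvd_one.mp ?_)
  rw [← h]
  exact Nat.gcd_dvd_gcd_of_dvd_left _ p.minFac_dvd

/-- `b ^ e % p`, evaluated through base `64` digits of `e`. Everything that is evaluated often is
written with the functions that the kernel accelerates, to keep the verification fast. -/
def powMod (b e p : ℕ) : ℕ :=
  (((b.pow (e.mod 64)).mul (((b.pow 64).mod p).pow ((e.div 64).mod 64))).mul
    (((((b.pow 64).mod p).pow 64).mod p).pow (e.div 4096))).mod p

theorem powMod_modEq (b e p : ℕ) : powMod b e p ≡ b ^ e [MOD p] := by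
  have h : powMod b e p ≡ b ^ (e % 64) * (b ^ 64) ^ (e / 64 % 64) *
      ((b ^ 64) ^ 64) ^ (e / 4096) [MOD p] :=
    (Nat.mod_modEq _ _).trans ((Nat.ModEq.rfl.mul ((Nat.mod_modEq _ _).pow _)).mul
      (((Nat.mod_modEq _ _).trans ((Nat.mod_modEq _ _).pow _)).pow _))
  simp only [← pow_mul, ← pow_add] at h
  convert h using 2
  omega

theorem powMod_cast (b e p : ℕ) : (powMod b e p : ZMod p) = (b : ZMod p) ^ e := by
  rw [(ZMod.natCast_eq_natCast_iff _ _ _).mpr (powMod_modEq b e p), Nat.cast_pow]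

/-- A prime `p ≡ 1 (mod 11)` with a root `r` of `r ^ 2 = r + 1` modulo `p`, and, modulo `p`, the
powers `ρ = r ^ M`, `σ = (1 - r) ^ M` and `κ = (2 * r - 1) ^ ((p - 1) / 11)`. -/
structure Witness where
  p : ℕ
  r : ℕ
  ρ : ℕ
  σ : ℕ
  κ : ℕ

namespace Witness

def IsValid (w : Witness) (M q : ℕ) : Prop :=
  (w.p = 331 ∨ w.p = 661 ∨ 1 < w.p ∧ w.p < 1000000 ∧ w.p.gcd smallPrimesProduct = 1) ∧
  w.p % 22 = 1 ∧ w.r * w.r % w.p = (w.r + 1) % w.p ∧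
  powMod w.r (M % (w.p - 1)) w.p = w.ρ ∧
  powMod (1 + (w.p - 1) * w.r) (M % (w.p - 1)) w.p = w.σ ∧
  powMod (2 * w.r + (w.p - 1)) (w.p / 11) w.p = w.κ ∧
  powMod w.ρ q w.p = powMod w.σ q w.p ∧
  (powMod w.ρ q w.p = 1 ∨ powMod w.ρ q w.p = w.p - 1)

instance (w : Witness) (M q : ℕ) : Decidable (w.IsValid M q) := by
  unfold IsValid
  infer_instance

/-- A multiple of `gibonacci c (M * s)` modulo `p`, up to a nonzero factor independent of `c`
and `s`. -/
def value (w : Witness) (c s : ℕ) : ℕ :=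
  ((((c.add w.r).add w.p.pred).mul (w.ρ.pow s)).add
    ((w.r.add (w.p.pred.mul c)).mul (w.σ.pow s))).mod w.p

/-- The `s`-th value in the sequence is not an eleventh power modulo `p`. -/
def excludes (w : Witness) (c s : ℕ) : Bool :=
  Nat.rec false (fun t _ => (Nat.beq t.succ w.κ).rec true false)
    (powMod (w.value c s) (w.p.div 11) w.p)

theorem ne_of_excludes {w : Witness} {c s : ℕ} (h : w.excludes c s = true) :
    powMod (w.value c s) (w.p / 11) w.p ≠ 0 ∧ powMod (w.value c s) (w.p / 11) w.p ≠ w.κ := by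
  change Nat.rec (motive := fun _ => Bool) false
    (fun t _ => Bool.rec (motive := fun _ => Bool) true false (Nat.beq t.succ w.κ))
    (powMod (w.value c s) (w.p / 11) w.p) = true at h
  generalize powMod (w.value c s) (w.p / 11) w.p = y at h ⊢
  cases y with
  | zero => simp at h
  | succ t =>
    refine ⟨t.succ_ne_zero, fun hk => ?_⟩
    simp [hk] at h

theorem IsValid.prime {w : Witness} {M q : ℕ} (h : w.IsValid M q) : w.p.Prime := by
  rcases h.1 with h | h | ⟨h₁, h₂, h₃⟩
  · rw [h]; norm_num
  · rw [h]; norm_num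
  · exact prime_of_gcd_smallPrimesProduct h₁ h₂ h₃

theorem IsValid.not_excludes {w : Witness} {M q c s : ℕ} {j x : ℤ} (hw : w.IsValid M q)
    (h : gibonacci c (M * (q * j + s)) = x ^ 11) : ¬ w.excludes c s = true := by
  have hp := hw.prime
  obtain ⟨-, hp22, hr, hρ, hσ, hκ, hρσ, hε⟩ := hw
  obtain ⟨p, r, ρ, σ, κ⟩ := w
  dsimp only at *
  intro hexc
  obtain ⟨hne0, hneκ⟩ := ne_of_excludes hexc
  dsimp only at hne0 hneκ
  have : Fact p.Prime := ⟨hp⟩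
  have hp1 : ((p - 1 : ℕ) : ZMod p) = -1 := by
    rw [Nat.cast_sub hp.one_le]; simp
  have hr' : (r : ZMod p) ^ 2 = r + 1 := by
    have := (ZMod.natCast_eq_natCast_iff _ _ _).mpr (show r * r ≡ r + 1 [MOD p] from hr)
    push_cast at this
    rw [sq, this]
  obtain ⟨h₀, h₁⟩ := ne_zero_of_sq_eq_add_one hr'
  have red : ∀ t : ZMod p, t ≠ 0 → t ^ (M % (p - 1)) = t ^ M := fun t ht => by
    conv_rhs => rw [← Nat.div_add_mod M (p - 1), pow_add, pow_mul,
      ZMod.pow_card_sub_one_eq_one ht, one_pow, one_mul]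
  have hρ' : (ρ : ZMod p) = (r : ZMod p) ^ M := by
    rw [← hρ, powMod_cast, red _ h₀]
  have hσ' : (σ : ZMod p) = (1 - r : ZMod p) ^ M := by
    rw [← hσ, powMod_cast, ← red _ h₁]
    push_cast
    rw [hp1]
    ring
  have hκ' : (κ : ZMod p) = (2 * r - 1 : ZMod p) ^ (p / 11) := by
    rw [← hκ, powMod_cast]
    push_cast
    rw [hp1]
    ring
  have hv : (value ⟨p, r, ρ, σ, κ⟩ c s : ZMod p) = ((c : ℤ) + r - 1) * ((r : ZMod p) ^ M) ^ s +
      (r - (c : ℤ)) * ((1 - r : ZMod p) ^ M) ^ s := by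
    change (((((c + r) + (p - 1)) * ρ ^ s + (r + (p - 1) * c) * σ ^ s) % p : ℕ) : ZMod p) = _
    rw [ZMod.natCast_mod]
    push_cast
    rw [hp1, hρ', hσ']
    ring
  have he : Even (p / 11) := ⟨p / 22, by omega⟩
  have h11 : 11 * (p / 11) = p - 1 := by omega
  have hx : (x : ZMod p) ^ (11 * (p / 11)) = 0 ∨ (x : ZMod p) ^ (11 * (p / 11)) = 1 := by
    rw [h11]
    by_cases h : (x : ZMod p) = 0
    · left
      rw [h, zero_pow]
      have := hp.two_le
      omega
    · exact Or.inr (ZMod.pow_card_sub_one_eq_one h)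
  have hρq : ((r : ZMod p) ^ M) ^ q = (powMod ρ q p : ℕ) := by rw [powMod_cast, hρ']
  have hσq : ((1 - r : ZMod p) ^ M) ^ q = (powMod ρ q p : ℕ) := by
    rw [hρσ, powMod_cast, hσ']
  have hε' : ((powMod ρ q p : ℕ) : ZMod p) = 1 ∨ ((powMod ρ q p : ℕ) : ZMod p) = -1 := by
    rcases hε with h | h
    · left; rw [h]; simp
    · right; rw [h, hp1]
  have hc : ((gibonacci c (M * (q * j + s)) : ℤ) : ZMod p) = (x : ZMod p) ^ 11 := by
    rw [h]; push_cast; rfl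
  have hlt : ∀ b e, powMod b e p < p := fun b e => Nat.mod_lt _ hp.pos
  have cancel : ∀ a b : ℕ, a < p → b < p → (a : ZMod p) = b → a = b := fun a b ha hb hab =>
    Nat.ModEq.eq_of_lt_of_lt ((ZMod.natCast_eq_natCast_iff _ _ _).mp hab) ha hb
  rcases pow_eq_of_gibonacci_eq_pow hr' hε' hρq hσq he hx hc with h | h
  · rw [← hv, ← powMod_cast] at h
    exact hne0 (cancel _ _ (hlt _ _) hp.pos (by simpa using h))
  · rw [← hv, ← powMod_cast, ← hκ'] at h
    exact hneκ (cancel _ _ (hlt _ _) (hκ ▸ hlt _ _) h)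

end Witness

def allBelow (f : ℕ → Bool) : ℕ → Bool :=
  Nat.rec true fun n ih => (f n).rec false ih

theorem of_allBelow {f : ℕ → Bool} {n : ℕ} (h : allBelow f n = true) {i : ℕ} (hi : i < n) :
    f i = true := by
  induction n with
  | zero => omega
  | succ n ih =>
    change Bool.rec (motive := fun _ => Bool) false (allBelow f n) (f n) = true at h
    cases hn : f n with
    | false => simp [hn] at h
    | true =>
      rcases Nat.lt_succ_iff_lt_or_eq.mp hi with hi | rfl
      · exact ih (by simpa [hn] using h) hi
      · exact hn

def anyExcludes (c s : ℕ) : List Witness → Bool :=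
  List.rec false fun w _ ih => (w.excludes c s).rec ih true

theorem of_anyExcludes {c s : ℕ} {L : List Witness} (h : anyExcludes c s L = true) :
    ∃ w ∈ L, w.excludes c s = true := by
  induction L with
  | nil => simp [anyExcludes] at h
  | cons w L ih =>
    change Bool.rec (motive := fun _ => Bool) (anyExcludes c s L) true (w.excludes c s) = true at h
    cases hw : w.excludes c s with
    | false =>
      obtain ⟨v, hv, hv'⟩ := ih (by simpa [hw] using h)
      exact ⟨v, List.mem_cons_of_mem _ hv, hv'⟩
    | true => exact ⟨w, List.mem_cons_self, hw⟩

/-- Every `s` with `0 < s < q` is excluded by a witness in `L`. The search runs in blocks of `64`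
to bound the depth of the recursion. -/
def excludesBelow (c q : ℕ) (L : List Witness) : Bool :=
  allBelow (fun i => allBelow (fun j =>
    (Nat.ble q ((i.mul 64).add j)).rec ((Nat.beq ((i.mul 64).add j) 0).rec
      (anyExcludes c ((i.mul 64).add j) L) true) true) 64) (q / 64 + 1)

theorem of_excludesBelow {c q : ℕ} {L : List Witness} (h : excludesBelow c q L = true) {s : ℕ}
    (h₀ : 0 < s) (hs : s < q) : ∃ w ∈ L, w.excludes c s = true := by
  have hblock := of_allBelow (of_allBelow h (i := s / 64) (by omega)) (i := s % 64)
    (Nat.mod_lt _ (by norm_num))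
  have e : ((s / 64).mul 64).add (s % 64) = s := Nat.div_add_mod' s 64
  have e₁ : Nat.ble q s = false := by rw [← Bool.not_eq_true, Nat.ble_eq]; omega
  have e₂ : Nat.beq s 0 = false := by rw [← Bool.not_eq_true, Nat.beq_eq]; omega
  simp only [e, e₁, e₂] at hblock
  exact of_anyExcludes hblock

/-- The initial values `c` of the sequences considered. -/
def seeds : List ℕ := [4, 5, 6, 7, 9, 10]

/-- The list of steps `(q, L)` leads from divisibility of the index by `M` to divisibility of the
index by `N`, each step adding a factor `q`. -/
def sieve (M N : ℕ) : List (ℕ × List Witness) → Bool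
  | [] => Nat.beq M N
  | (q, L) :: steps => Nat.blt 0 q && L.all (fun w => decide (w.IsValid M q)) &&
      seeds.all (fun c => excludesBelow c q L) && sieve (M * q) N steps

theorem dvd_of_sieve {M N : ℕ} {steps : List (ℕ × List Witness)}
    (h : sieve M N steps = true) {c : ℕ} (hc : c ∈ seeds) {m x : ℤ}
    (hx : gibonacci c m = x ^ 11) (hM : (M : ℤ) ∣ m) : (N : ℤ) ∣ m := by
  induction steps generalizing M with
  | nil => rwa [← Nat.eq_of_beq_eq_true h]
  | cons step steps ih =>
    obtain ⟨q, L⟩ := step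
    simp only [sieve, Bool.and_eq_true, List.all_eq_true, decide_eq_true_eq, Nat.blt_eq] at h
    obtain ⟨⟨⟨hq, hL⟩, hex⟩, hrest⟩ := h
    refine ih hrest ?_
    obtain ⟨k, rfl⟩ := hM
    push_cast
    refine mul_dvd_mul_left _ (Int.dvd_of_emod_eq_zero ?_)
    have hq' : (0 : ℤ) < q := by exact_mod_cast hq
    obtain ⟨s, hs⟩ := Int.eq_ofNat_of_zero_le (Int.emod_nonneg k hq'.ne')
    have hlt : s < q := by have := Int.emod_lt_of_pos k hq'; omega
    rcases Nat.eq_zero_or_pos s with rfl | h₀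
    · simpa using hs
    · obtain ⟨w, hw, hws⟩ := of_excludesBelow (hex c hc) h₀ hlt
      refine absurd hws ((hL w hw).not_excludes (j := k / q) (x := x) ?_)
      rw [← hs, Int.mul_ediv_add_emod]
      exact hx

def stepsUpTo2310 : List (ℕ × List Witness) := [
  (2310, [⟨331, 117, 117, 215, 74⟩, ⟨661, 58, 58, 604, 9⟩, ⟨2311, 108, 108, 2204, 620⟩, ⟨4621,
    2955, 2955, 1667, 3824⟩]),
  (2, [⟨1321, 869, 257, 1064, 925⟩, ⟨9241, 2257, 1829, 7412, 2444⟩]),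
  (5, [⟨3301, 1371, 454, 1476, 1⟩, ⟨11551, 9170, 11238, 2694, 7678⟩]),
  (2, [⟨18481, 1693, 10404, 8077, 4811⟩]),
  (3, [⟨4951, 2089, 2689, 2261, 2026⟩]),
  (2, [⟨79201, 42719, 1435, 77766, 29746⟩]),
  (3, [⟨2971, 1880, 54, 2916, 2784⟩, ⟨14851, 273, 12016, 2834, 1⟩]),
  (3, [⟨7129, 2405, 1249, 5879, 2237⟩, ⟨89101, 299, 15461, 73639, 23056⟩]),
  (2, [⟨285121, 187894, 14427, 270694, 59722⟩]),
  (2, [⟨29569, 6868, 23470, 6099, 18628⟩]),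
  (2, [⟨14081, 5266, 7890, 6191, 8332⟩]),
  (2, [⟨84481, 42723, 80350, 4131, 72335⟩]),
  (3, [⟨26731, 26568, 14802, 11928, 13025⟩, ⟨187111, 185226, 155022, 32088, 63532⟩]),
  (3, [⟨80191, 4645, 71089, 9101, 8519⟩, ⟨641521, 400851, 579412, 62108, 583780⟩]),
  (3, [⟨240571, 236934, 35932, 204638, 105175⟩, ⟨336799, 171942, 4381, 332417, 257687⟩]),
  (5, [⟨5501, 2874, 592, 2035, 5492⟩, ⟨38501, 27228, 19612, 7615, 31913⟩]),
  (5, [⟨13751, 4977, 9338, 13187, 11223⟩, ⟨165001, 91333, 156947, 81722, 137380⟩]),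
  (5, [⟨206251, 49561, 1449, 48111, 17535⟩, ⟨825001, 283623, 500099, 608524, 636898⟩]),
  (7, [⟨6469, 4340, 936, 1403, 3015⟩, ⟨10781, 6840, 9762, 10252, 1⟩, ⟨26951, 25734, 24504, 793,
    15661⟩]),
  (7, [⟨22639, 15043, 16606, 7794, 6244⟩, ⟨226381, 173783, 155370, 50354, 94923⟩]),
  (11, [⟨3389, 3076, 1739, 2894, 3175⟩, ⟨3631, 3307, 2304, 1691, 343⟩]),
  (11, [⟨79861, 18551, 72875, 78775, 72875⟩, ⟨130439, 124494, 38386, 24524, 109442⟩, ⟨159721,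
    25431, 158180, 85302, 1⟩]),
  (13, [⟨2861, 2808, 632, 2440, 1245⟩, ⟨7151, 1539, 3336, 2523, 6304⟩]),
  (13, [⟨3719, 2610, 941, 2810, 1958⟩, ⟨37181, 36341, 24319, 27072, 25915⟩, ⟨78079, 11491,
    52800, 56313, 5258⟩]),
  (17, [⟨1871, 672, 243, 77, 1424⟩, ⟨7481, 87, 3386, 2870, 3384⟩, ⟨10099, 101, 47, 1719, 4397⟩]),
  (17, [⟨6359, 4328, 4448, 6166, 3462⟩, ⟨38149, 21582, 19044, 35022, 18636⟩]),
  (19, [⟨6271, 3975, 25, 4766, 1⟩, ⟨6689, 6333, 200, 6388, 1887⟩, ⟨8779, 790, 7212, 4622, 7190⟩]),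
  (2, [⟨394241, 91532, 280578, 113663, 1⟩]),
  (19, [⟨31769, 30088, 19506, 22194, 14588⟩, ⟨71479, 10678, 28373, 22235, 36660⟩, ⟨119131,
    71780, 111369, 83846, 79482⟩]),
  (23, [⟨2531, 113, 933, 255, 39⟩, ⟨4049, 1137, 2712, 2877, 3071⟩, ⟨7591, 5766, 7549, 3434,
    6594⟩]),
  (23, [⟨69829, 66805, 68364, 26168, 26695⟩, ⟨116381, 12806, 26141, 67916, 93759⟩]),
  (29, [⟨3191, 3135, 427, 1943, 1928⟩, ⟨7019, 1030, 4900, 2322, 3100⟩]),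
  (29, [⟨185021, 157991, 150714, 178614, 118988⟩, ⟨277531, 70493, 93547, 24719, 193084⟩,
    ⟨832591, 698205, 217464, 323876, 578375⟩]),
  (31, [⟨2729, 2395, 652, 2323, 1119⟩, ⟨12959, 11771, 7077, 2787, 3072⟩]),
  (37, [⟨9769, 2964, 8770, 5437, 1⟩, ⟨12211, 367, 6, 10176, 1⟩, ⟨17909, 7534, 9388, 16587, 3549⟩]),
  (37, [⟨30119, 24247, 8453, 25038, 24226⟩, ⟨301181, 294349, 107391, 292013, 15344⟩, ⟨451771,
    154667, 235388, 105853, 404079⟩]),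
  (41, [⟨18041, 7334, 3101, 5556, 10520⟩, ⟨21649, 11069, 9441, 19693, 1⟩]),
  (41, [⟨369821, 38897, 271030, 281127, 122272⟩, ⟨554731, 419114, 245232, 494318, 310730⟩,
    ⟨887569, 157056, 796619, 612164, 233668⟩]),
  (43, [⟨9461, 9244, 5695, 3188, 1166⟩, ⟨17029, 16899, 11578, 9900, 5055⟩, ⟨26489, 23158, 3585,
    8874, 20009⟩]),
  (47, [⟨2069, 2024, 1427, 1389, 1⟩, ⟨5171, 4933, 2168, 3790, 4036⟩, ⟨12409, 5038, 1870, 4519,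
    1⟩]),
  (53, [⟨3499, 1519, 169, 1470, 1610⟩, ⟨17491, 5439, 1832, 15782, 6317⟩, ⟨23321, 7943, 9888,
    8960, 9883⟩, ⟨34981, 31641, 29201, 8600, 21638⟩]),
  (59, [⟨6491, 598, 1438, 3083, 830⟩, ⟨7789, 6705, 6004, 7741, 2222⟩, ⟨19471, 15756, 18710,
    6243, 2040⟩]),
  (61, [⟨13421, 1210, 13367, 10190, 12742⟩, ⟨53681, 12015, 11497, 2526, 2194⟩, ⟨72469, 59840,
    40585, 2457, 39212⟩]),
  (67, [⟨14741, 7033, 3724, 11032, 1365⟩, ⟨22111, 333, 2764, 8, 11538⟩, ⟨32429, 29465, 22752,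
    24212, 28270⟩]),
  (71, [⟨23431, 14880, 14452, 20858, 13194⟩, ⟨37489, 31382, 20008, 29018, 35835⟩, ⟨46861, 31169,
    7484, 6130, 35157⟩]),
  (73, [⟨16061, 12687, 11670, 2586, 7498⟩, ⟨20879, 145, 7396, 13813, 19194⟩, ⟨24091, 18918,
    13950, 1967, 18091⟩]),
  (79, [⟨10429, 861, 5940, 230, 9346⟩, ⟨27809, 17402, 18447, 18372, 9752⟩, ⟨43451, 20108, 19580,
    18794, 20530⟩, ⟨104281, 59140, 41556, 60675, 49974⟩]),
  (83, [⟨5479, 246, 1917, 5056, 762⟩, ⟨32869, 8873, 19087, 27491, 30114⟩, ⟨41999, 37111, 4437,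
    11567, 3468⟩, ⟨60259, 20005, 58975, 55519, 25851⟩])]

theorem sieve_stepsUpTo2310 :
    sieve 1
      784697806671602431793311655560457952999086500286400000
      stepsUpTo2310 = true := by
  decide +kernel

def stepsUpTo199 : List (ℕ × List Witness) := [
  (89, [⟨9791, 3741, 4307, 7154, 4090⟩, ⟨50909, 984, 21552, 2596, 37172⟩, ⟨58741, 27984, 40141,
    9667, 33139⟩, ⟨70489, 70224, 34839, 55974, 11527⟩]),
  (97, [⟨14939, 8345, 11532, 9344, 10680⟩, ⟨21341, 8146, 11160, 7150, 3904⟩, ⟨25609, 23296,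
    17371, 8956, 2639⟩]),
  (101, [⟨33331, 22560, 28659, 13662, 19801⟩, ⟨64439, 63333, 60310, 53296, 20527⟩, ⟨99991,
    55048, 20761, 91890, 42390⟩]),
  (103, [⟨74779, 28156, 48489, 54069, 1⟩, ⟨90641, 76206, 72584, 47612, 29000⟩, ⟨108769, 30972,
    93264, 10691, 46857⟩]),
  (107, [⟨35311, 10695, 14531, 11064, 1⟩, ⟨63559, 26575, 57272, 738, 1⟩, ⟨70621, 38095, 39181,
    55933, 11429⟩]),
  (109, [⟨2399, 214, 494, 811, 1430⟩, ⟨14389, 10033, 5322, 9617, 3443⟩, ⟨23981, 9355, 539, 5339,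
    14571⟩, ⟨59951, 548, 28131, 31560, 15530⟩]),
  (113, [⟨7459, 6043, 5932, 3009, 1⟩, ⟨19889, 15661, 6937, 19436, 5576⟩, ⟨57179, 54683, 33244,
    3366, 44583⟩]),
  (127, [⟨19559, 18664, 4983, 14158, 13714⟩, ⟨27941, 16168, 4115, 26033, 1842⟩, ⟨33529, 27105,
    24580, 5635, 33250⟩]),
  (131, [⟨14411, 10542, 13766, 5608, 1⟩, ⟨25939, 16816, 21620, 21789, 6195⟩, ⟨57641, 3438,
    45355, 49989, 57523⟩]),
  (137, [⟨6029, 1274, 5305, 4172, 1178⟩, ⟨51239, 10854, 21199, 18488, 10916⟩, ⟨105491, 11200,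
    54734, 29390, 93823⟩]),
  (139, [⟨122321, 120797, 104133, 37884, 1⟩, ⟨201829, 73737, 195274, 124823, 166444⟩, ⟨229351,
    46484, 97916, 12679, 138787⟩]),
  (149, [⟨49171, 31461, 35683, 46353, 10356⟩, ⟨85229, 62133, 32978, 7730, 1⟩, ⟨134399, 97112,
    78047, 76241, 26046⟩, ⟨163901, 34664, 129473, 62465, 124116⟩]),
  (151, [⟨49831, 5731, 27300, 44408, 23995⟩, ⟨99661, 93918, 25400, 22204, 73795⟩, ⟨149491,
    57086, 58827, 126267, 133192⟩]),
  (157, [⟨24179, 156, 18100, 7589, 1⟩, ⟨75989, 66760, 51985, 535, 72612⟩, ⟨86351, 69935, 7301,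
    9450, 1⟩]),
  (163, [⟨46619, 36444, 21707, 25935, 32587⟩, ⟨53791, 14224, 43252, 38331, 23828⟩, ⟨107581,
    60038, 99469, 41868, 90580⟩]),
  (167, [⟨7349, 5748, 1237, 5537, 4618⟩, ⟨18371, 16548, 5888, 1663, 1⟩, ⟨44089, 17905, 34589,
    6075, 1⟩, ⟨62459, 17425, 8741, 21458, 56339⟩]),
  (173, [⟨19031, 17314, 2792, 14839, 17188⟩, ⟨30449, 175, 29457, 23113, 25648⟩, ⟨87539, 52145,
    33474, 70674, 6429⟩]),
  (179, [⟨23629, 11245, 7201, 16433, 16010⟩, ⟨43319, 20170, 14704, 7757, 1⟩, ⟨82699, 76813,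
    47012, 58981, 44002⟩, ⟨137831, 101625, 136012, 76758, 1⟩]),
  (181, [⟨35839, 3763, 9464, 7214, 8962⟩, ⟨39821, 25494, 3344, 27758, 4664⟩, ⟨75659, 66352,
    5895, 1938, 46282⟩, ⟨95569, 10351, 59963, 44263, 88233⟩]),
  (191, [⟨21011, 15490, 6432, 7020, 10654⟩, ⟨63031, 32192, 21115, 10639, 33499⟩, ⟨210101, 4786,
    184232, 121964, 1⟩]),
  (193, [⟨12739, 7316, 8623, 3030, 3081⟩, ⟨42461, 23514, 22651, 15992, 4528⟩, ⟨63691, 6208,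
    6352, 48420, 52133⟩, ⟨182579, 8319, 17219, 95727, 113826⟩]),
  (197, [⟨8669, 908, 6269, 2272, 6623⟩, ⟨52009, 4533, 20316, 51945, 1⟩, ⟨65011, 10392, 19095,
    51270, 17745⟩, ⟨73679, 44875, 16147, 11079, 50⟩]),
  (199, [⟨43781, 36369, 34263, 4862, 31763⟩, ⟨91939, 80919, 39033, 66590, 39602⟩, ⟨109451,
    41797, 106350, 84956, 82167⟩, ⟨135719, 37590, 83619, 117169, 107870⟩, ⟨201389, 192653,
    94890, 27444, 3637⟩])]

theorem sieve_stepsUpTo199 :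
    sieve 784697806671602431793311655560457952999086500286400000
      22917989320002632466574417899915613138921596944189941241384081552503247490631144737723341784740289600000
      stepsUpTo199 = true := by
  decide +kernel

def stepsUpTo281 : List (ℕ × List Witness) := [
  (211, [⟨111409, 72286, 92075, 19736, 37074⟩, ⟨181039, 60205, 59513, 5576, 175203⟩, ⟨185681,
    116105, 25593, 146924, 36078⟩, ⟨208891, 64864, 76214, 201329, 25595⟩]),
  (223, [⟨122651, 51351, 7351, 73347, 13512⟩, ⟨137369, 76718, 64470, 129253, 125282⟩, ⟨220771,
    171137, 73981, 202499, 18488⟩]),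
  (227, [⟨24971, 2285, 14673, 20051, 7989⟩, ⟨59929, 17898, 44352, 46729, 1⟩, ⟨99881, 73780,
    86708, 67755, 68644⟩, ⟨134839, 9427, 21749, 129222, 55831⟩]),
  (229, [⟨5039, 1969, 3099, 3426, 1974⟩, ⟨75571, 3423, 49393, 57335, 29214⟩, ⟨151141, 138514,
    148032, 74185, 70298⟩, ⟨256939, 197004, 150457, 74245, 218225⟩]),
  (233, [⟨92269, 9697, 68000, 13801, 16788⟩, ⟨117899, 33026, 61774, 27779, 52378⟩, ⟨169159,
    53782, 57516, 141257, 11060⟩]),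
  (239, [⟨57839, 241, 5895, 12078, 2288⟩, ⟨110419, 63519, 109219, 34874, 22245⟩, ⟨136709,
    133594, 77684, 18793, 1129⟩, ⟨184031, 37861, 96526, 42453, 149178⟩]),
  (241, [⟨79531, 76871, 78464, 75506, 1⟩, ⟨127249, 32293, 19210, 45183, 37859⟩, ⟨206779, 168612,
    206370, 105159, 168720⟩, ⟨212081, 179036, 39586, 49562, 189969⟩]),
  (251, [⟨27611, 23187, 1865, 20860, 14084⟩, ⟨110441, 83949, 48728, 103186, 103232⟩, ⟨132529,
    42842, 105447, 44253, 65732⟩, ⟨215359, 191028, 183921, 23517, 189114⟩]),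
  (257, [⟨84811, 79371, 43811, 19219, 50203⟩, ⟨113081, 102832, 26226, 53505, 103950⟩, ⟨197891,
    135837, 96940, 193500, 1⟩, ⟨265739, 516, 145485, 223273, 254281⟩, ⟨350549, 343274, 9774,
    322825, 195096⟩]),
  (263, [⟨17359, 13129, 10785, 573, 14440⟩, ⟨104149, 43369, 30594, 5634, 94413⟩, ⟨347161, 1318,
    16820, 51166, 110520⟩, ⟨451309, 388609, 375522, 348300, 1⟩]),
  (269, [⟨35509, 24139, 5466, 20418, 21753⟩, ⟨65099, 33237, 55210, 46930, 26539⟩, ⟨88771, 50956,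
    47854, 36138, 1⟩, ⟨118361, 40854, 109037, 27940, 8875⟩]),
  (271, [⟨59621, 3445, 13106, 32449, 57977⟩, ⟨89431, 75549, 85917, 74441, 25493⟩, ⟨113279,
    22058, 44530, 23508, 53010⟩]),
  (277, [⟨91411, 58903, 85502, 14851, 35043⟩, ⟨182821, 105065, 73510, 5270, 27731⟩, ⟨225479,
    222439, 9752, 50890, 170780⟩]),
  (281, [⟨30911, 27627, 12337, 13312, 19423⟩, ⟨55639, 39818, 39593, 49297, 19641⟩, ⟨216371,
    60419, 21884, 123916, 46945⟩, ⟨272009, 102721, 260397, 210472, 1⟩])]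

theorem sieve_stepsUpTo281 :
    sieve 22917989320002632466574417899915613138921596944189941241384081552503247490631144737723341784740289600000
      72421295317231772204756986294686082335201469578648321317734158017927441768377372475124208018003774884838044827166064313574051905534400000
      stepsUpTo281 = true := by
  decide +kernel

def stepsUpTo349 : List (ℕ × List Witness) := [
  (283, [⟨18679, 8972, 8708, 18398, 10970⟩, ⟨112069, 64941, 55532, 82853, 76137⟩, ⟨174329,
    93697, 82217, 2167, 859⟩]),
  (293, [⟨193381, 154997, 74967, 10166, 26963⟩, ⟨225611, 185676, 10193, 15206, 67547⟩, ⟨438329,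
    221620, 276710, 20151, 69418⟩]),
  (307, [⟨47279, 3362, 1352, 1154, 38608⟩, ⟨81049, 75870, 31519, 81031, 40945⟩, ⟨168851, 160125,
    149290, 57308, 52573⟩, ⟨202621, 93137, 170987, 38937, 114566⟩]),
  (311, [⟨34211, 14750, 25431, 6511, 20883⟩, ⟨95789, 95480, 22055, 33056, 88601⟩, ⟨136841,
    52091, 96167, 111484, 71739⟩, ⟨164209, 39182, 155760, 77372, 66635⟩]),
  (313, [⟨89519, 82370, 37572, 68707, 80868⟩, ⟨103291, 31291, 87844, 16717, 78363⟩, ⟨296099,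
    96989, 121642, 107126, 1⟩, ⟨399389, 125620, 58530, 45043, 49279⟩]),
  (317, [⟨34871, 15170, 18442, 24356, 1⟩, ⟨83689, 71871, 57428, 9331, 32530⟩, ⟨188299, 57074,
    162503, 138830, 1⟩, ⟨209221, 37466, 6933, 21245, 1⟩]),
  (331, [⟨29129, 21514, 12419, 27140, 1⟩, ⟨65539, 9445, 23754, 46151, 17576⟩, ⟨218461, 180660,
    135215, 44332, 51659⟩, ⟨356819, 77841, 160988, 37983, 220847⟩, ⟨509741, 342073, 241047,
    226486, 375455⟩]),
  (337, [⟨51899, 16537, 44457, 34067, 1⟩, ⟨88969, 4631, 1517, 48150, 2052⟩, ⟨111211, 37182,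
    41520, 110003, 34529⟩, ⟨163109, 93397, 71424, 124129, 136650⟩]),
  (347, [⟨15269, 7979, 6911, 4854, 4726⟩, ⟨152681, 15139, 95698, 28308, 75712⟩, ⟨343531, 144676,
    263439, 33177, 83069⟩, ⟨435139, 157032, 411955, 308017, 378752⟩, ⟨496211, 202074, 428435,
    320228, 422208⟩]),
  (349, [⟨76781, 33773, 14644, 68911, 51290⟩, ⟨122849, 351, 8938, 43694, 28923⟩, ⟨230341,
    218021, 69451, 181723, 38270⟩, ⟨238019, 166565, 59608, 190761, 114043⟩])]

theorem sieve_stepsUpTo349 :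
    sieve 72421295317231772204756986294686082335201469578648321317734158017927441768377372475124208018003774884838044827166064313574051905534400000
      768485194410460682877764138114479186340386338224936912357065814465669314120261087800225666902059152901331626760681311355735491471170652415082299122078469179200000
      stepsUpTo349 = true := by
  decide +kernel

def stepsUpTo401 : List (ℕ × List Witness) := [
  (353, [⟨62129, 12209, 60394, 22524, 56440⟩, ⟨116491, 57327, 33531, 62979, 111385⟩, ⟨256279,
    117824, 127383, 4404, 178313⟩, ⟨271811, 24758, 111304, 125495, 104696⟩]),
  (359, [⟨47389, 24056, 26554, 38357, 27297⟩, ⟨118471, 107260, 118308, 27619, 37722⟩, ⟨323819,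
    303854, 282812, 229738, 83896⟩, ⟨513371, 512655, 408346, 74206, 143573⟩]),
  (367, [⟨56519, 16980, 54561, 1934, 16862⟩, ⟨605551, 30149, 58747, 223586, 489621⟩, ⟨702439,
    345220, 28063, 103252, 481853⟩, ⟨904289, 436014, 783920, 347392, 212975⟩]),
  (373, [⟨123091, 25068, 57112, 88997, 103503⟩, ⟨147709, 122522, 58145, 10418, 29607⟩, ⟨205151,
    106758, 169220, 48383, 21466⟩, ⟨270799, 110242, 36214, 79795, 245458⟩]),
  (379, [⟨383549, 239114, 29716, 87859, 315717⟩, ⟨508619, 244043, 18183, 169204, 286148⟩,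
    ⟨550309, 23820, 128868, 441770, 389087⟩]),
  (383, [⟨42131, 13209, 4420, 14193, 30631⟩, ⟨67409, 49684, 4927, 39526, 31329⟩, ⟨193799,
    151508, 110123, 11087, 177230⟩, ⟨294911, 255785, 287275, 38737, 23601⟩]),
  (389, [⟨51349, 21377, 41159, 24838, 10617⟩, ⟨171161, 107464, 124475, 116824, 80679⟩, ⟨179719,
    107289, 46612, 54538, 1⟩]),
  (397, [⟨131011, 44998, 38633, 10828, 80111⟩, ⟨192149, 43175, 44781, 9530, 36067⟩, ⟨366829,
    254726, 127205, 177758, 71451⟩, ⟨393031, 181029, 171410, 227, 1⟩]),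
  (401, [⟨44111, 26284, 1471, 16253, 25340⟩, ⟨79399, 55608, 23376, 3400, 55680⟩, ⟨132331,
    131125, 67851, 123734, 42243⟩, ⟨255839, 186855, 95605, 51034, 21989⟩])]

theorem sieve_stepsUpTo401 :
    sieve 768485194410460682877764138114479186340386338224936912357065814465669314120261087800225666902059152901331626760681311355735491471170652415082299122078469179200000
      119840060470513436886148228354149578836061051065381306191615038432520979008642398920836159703984404824380026991209166688227046899577072529947661180708247060742260541429773455100526400000
      stepsUpTo401 = true := by
  decide +kernel

def stepsUpTo449 : List (ℕ × List Witness) := [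
  (409, [⟨8999, 8586, 19, 5210, 4665⟩, ⟨224951, 181047, 132498, 39648, 10312⟩, ⟨539881, 321963,
    314085, 261933, 333881⟩, ⟨593869, 129317, 497991, 549427, 420077⟩]),
  (419, [⟨46091, 35021, 45756, 33158, 12895⟩, ⟨101399, 44118, 29457, 35032, 16503⟩, ⟨322631,
    170028, 241391, 227601, 1⟩, ⟨516209, 310646, 333148, 298244, 500912⟩, ⟨608389, 503757,
    548936, 521909, 319441⟩]),
  (421, [⟨37049, 26668, 11859, 15177, 34711⟩, ⟨175979, 420, 146840, 133867, 18147⟩, ⟨222289,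
    102874, 30180, 78302, 205179⟩, ⟨231551, 181588, 58497, 102901, 146651⟩]),
  (431, [⟨132749, 55507, 90523, 87683, 92047⟩, ⟨142231, 15343, 128128, 24396, 57428⟩, ⟨227569,
    159885, 156479, 200036, 216719⟩, ⟨331871, 71618, 270200, 88641, 129240⟩]),
  (433, [⟨28579, 25966, 14763, 19616, 17441⟩, ⟨95261, 69125, 45310, 39923, 9460⟩, ⟨171469,
    167563, 165328, 157508, 1⟩]),
  (439, [⟨96581, 45733, 48434, 34998, 76098⟩, ⟨289741, 207897, 34515, 152858, 268113⟩, ⟨434611,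
    185950, 370240, 139442, 102391⟩, ⟨589139, 469709, 314792, 467320, 400582⟩]),
  (443, [⟨48731, 15773, 13752, 22413, 45951⟩, ⟨77969, 70856, 23150, 49917, 21279⟩, ⟨146191,
    79276, 79986, 134225, 98698⟩, ⟨292381, 230922, 15484, 209580, 192348⟩]),
  (449, [⟨49391, 9432, 8810, 14907, 12610⟩, ⟨148171, 94586, 72583, 65925, 115555⟩, ⟨345731,
    129970, 172793, 88221, 166⟩, ⟨355609, 235599, 120079, 314193, 1⟩])]

theorem sieve_stepsUpTo449 :
    sieve 119840060470513436886148228354149578836061051065381306191615038432520979008642398920836159703984404824380026991209166688227046899577072529947661180708247060742260541429773455100526400000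
      140896822909765350113021776613849090801339009088716757784472521410602654401074916377979164932647998545081330017669874019460188029500340514822137493466788934377016393459577573542906204707949844185713729600000
      stepsUpTo449 = true := by
  decide +kernel

def stepsUpTo491 : List (ℕ × List Witness) := [
  (457, [⟨70379, 43462, 53672, 63462, 33103⟩, ⟨371999, 16648, 315884, 182960, 132702⟩, ⟨552971,
    154568, 36655, 87709, 312703⟩, ⟨673619, 535576, 399183, 163854, 222097⟩]),
  (461, [⟨202841, 149821, 104797, 185870, 1⟩, ⟨354971, 25313, 21818, 252456, 310789⟩, ⟨598379,
    508838, 366126, 217364, 74958⟩, ⟨608521, 96771, 217666, 142878, 465547⟩]),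
  (463, [⟨30559, 7125, 3658, 22347, 11512⟩, ⟨152791, 93926, 54745, 39880, 131926⟩, ⟨183349,
    157020, 93569, 93102, 166462⟩, ⟨305581, 171148, 98155, 301375, 250166⟩]),
  (467, [⟨20549, 17546, 8651, 16081, 19932⟩, ⟨123289, 55386, 72416, 19870, 29771⟩, ⟨154111,
    56521, 76654, 80606, 24231⟩, ⟨174659, 26083, 90557, 25218, 18933⟩]),
  (479, [⟨52691, 3564, 33661, 32592, 35483⟩, ⟨158071, 152379, 112873, 65431, 37131⟩, ⟨210761,
    149013, 118440, 17010, 1⟩]),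
  (487, [⟨160711, 11750, 109982, 68157, 68600⟩, ⟨449989, 242841, 183316, 391633, 52651⟩,
    ⟨610699, 452964, 295074, 452133, 372031⟩, ⟨910691, 873376, 265935, 58932, 861204⟩, ⟨932119,
    67022, 808330, 175394, 396399⟩]),
  (491, [⟨54011, 50684, 10456, 45524, 47914⟩, ⟨378071, 103422, 184540, 343548, 253730⟩, ⟨421279,
    26691, 410981, 95113, 282991⟩, ⟨475289, 36147, 304188, 168853, 26262⟩])]

theorem sieve_stepsUpTo491 :
    sieve 140896822909765350113021776613849090801339009088716757784472521410602654401074916377979164932647998545081330017669874019460188029500340514822137493466788934377016393459577573542906204707949844185713729600000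
      735126644744599800112642711825435953903314768612202503590750790726069480694539303322957656379910122258441233647319981908907365716814337580604712280482866763991052163859556450742994206715760232691522832364265772764083217600000
      stepsUpTo491 = true := by
  decide +kernel

def stepsUpTo541 : List (ℕ × List Witness) := [
  (499, [⟨10979, 989, 9916, 3429, 6571⟩, ⟨175649, 22952, 110320, 36351, 114904⟩, ⟨230539,
    109365, 58938, 155668, 126959⟩, ⟨274451, 27498, 118297, 162429, 177329⟩]),
  (503, [⟨33199, 28515, 21552, 3945, 9588⟩, ⟨55331, 39118, 38465, 1473, 6427⟩, ⟨254519, 505,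
    108332, 174462, 1⟩, ⟨365179, 352518, 278158, 254397, 57954⟩]),
  (509, [⟨67189, 6085, 35854, 50730, 1⟩, ⟨167971, 162869, 127952, 12042, 127146⟩, ⟨235159,
    89608, 104040, 134353, 200294⟩, ⟨335941, 102633, 116290, 47316, 307898⟩]),
  (521, [⟨332399, 105334, 139497, 195207, 189728⟩, ⟨447019, 104479, 203694, 41159, 73626⟩,
    ⟨573101, 530017, 508670, 365354, 63670⟩, ⟨676259, 376192, 611286, 171633, 492939⟩]),
  (523, [⟨34519, 3721, 31507, 4206, 2910⟩, ⟨115061, 68516, 7521, 109477, 114369⟩, ⟨149579,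
    80969, 96334, 89444, 47447⟩, ⟨322169, 181938, 46972, 284878, 268905⟩]),
  (541, [⟨47609, 39954, 14175, 37486, 6970⟩, ⟨107119, 106034, 21823, 106314, 105213⟩, ⟨178531,
    62929, 127685, 106962, 33212⟩, ⟨476081, 201643, 52694, 124274, 236554⟩])]

theorem sieve_stepsUpTo541 :
    sieve 735126644744599800112642711825435953903314768612202503590750790726069480694539303322957656379910122258441233647319981908907365716814337580604712280482866763991052163859556450742994206715760232691522832364265772764083217600000
      13844751161837804915239664964364856364579158430646763178565762674798740434218033166399318641882172721123011818644268182842529910004470816878481648502201107877579776929976777210103787209912671474735767247438175194760016679137980914535214400000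
      stepsUpTo541 = true := by
  decide +kernel

def stepsUpTo577 : List (ℕ × List Witness) := [
  (547, [⟨84239, 76555, 34223, 43573, 13397⟩, ⟨144409, 8421, 59954, 11010, 10057⟩, ⟨180511,
    126587, 110046, 61727, 30175⟩, ⟨264749, 55272, 214240, 114000, 69287⟩, ⟨300851, 300303,
    115563, 176377, 127131⟩]),
  (557, [⟨24509, 21207, 49, 19007, 8332⟩, ⟨208319, 6141, 39342, 29806, 37064⟩, ⟨330859, 278333,
    212393, 251215, 61182⟩, ⟨367621, 12142, 278858, 70225, 321052⟩]),
  (563, [⟨37159, 17200, 11409, 7921, 14122⟩, ⟨99089, 46954, 35858, 81782, 86007⟩, ⟨470669,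
    284395, 242476, 243062, 174132⟩, ⟨557371, 218277, 471401, 549403, 1⟩]),
  (569, [⟨62591, 43553, 52434, 38792, 61318⟩, ⟨75109, 64670, 10696, 41199, 1⟩, ⟨137699, 53504,
    87786, 63783, 30615⟩]),
  (571, [⟨125621, 6716, 80181, 123578, 13309⟩, ⟨188431, 32161, 148517, 41851, 68292⟩, ⟨301489,
    57313, 186754, 30794, 283713⟩, ⟨615539, 300033, 393044, 156071, 292316⟩]),
  (577, [⟨279269, 2304, 167725, 87741, 247767⟩, ⟨317351, 256274, 180318, 74585, 260164⟩,
    ⟨533149, 454674, 356202, 532456, 192386⟩, ⟨571231, 497337, 460765, 244619, 13948⟩])]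

theorem sieve_stepsUpTo577 :
    sieve 13844751161837804915239664964364856364579158430646763178565762674798740434218033166399318641882172721123011818644268182842529910004470816878481648502201107877579776929976777210103787209912671474735767247438175194760016679137980914535214400000
      445205231035422524213782125578656081249203866096134116098997317544435107284570692998018836570226979893421298463364084524890882198730037941678848999286654309406502435117678880022127105791168459119256111098082847110879754602049939087188799177012447484702400000
      stepsUpTo577 = true := by
  decide +kernel

def stepsUpTo617 : List (ℕ × List Witness) := [
  (593, [⟨39139, 10202, 38080, 13342, 36447⟩, ⟨104369, 24389, 91323, 8, 30367⟩, ⟨195691, 143904,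
    60688, 29037, 17206⟩, ⟨260921, 38872, 189225, 220718, 92405⟩]),
  (599, [⟨263561, 178419, 192009, 69047, 156141⟩, ⟨276739, 162050, 202158, 275021, 253951⟩,
    ⟨672079, 52050, 298765, 604753, 76061⟩, ⟨737969, 148914, 656955, 435955, 307454⟩]),
  (601, [⟨52889, 41274, 46509, 44508, 18114⟩, ⟨251219, 37337, 79726, 249842, 137053⟩, ⟨449549,
    77820, 278815, 233374, 416343⟩, ⟨528881, 519945, 501382, 57929, 403279⟩]),
  (607, [⟨93479, 71733, 65310, 57669, 5716⟩, ⟨133541, 101477, 88376, 60483, 70909⟩, ⟨560869,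
    17580, 402019, 334470, 120473⟩, ⟨600931, 228255, 451, 555628, 29962⟩]),
  (617, [⟨162889, 69939, 18927, 96785, 132428⟩, ⟨407221, 176652, 277465, 364555, 118146⟩,
    ⟨475091, 287774, 106800, 154756, 371712⟩, ⟨570109, 73007, 398274, 256311, 81823⟩])]

theorem sieve_stepsUpTo617 :
    sieve 445205231035422524213782125578656081249203866096134116098997317544435107284570692998018836570226979893421298463364084524890882198730037941678848999286654309406502435117678880022127105791168459119256111098082847110879754602049939087188799177012447484702400000
      35595090494495708735551513774339790404327494231688708370638369570081510775836987394757169596642528583802601919462746958600907520736816715650879090093549160086607186640044350998256614021872413802722317829140833018825025279343256943476968875970600805985607171630607659200000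
      stepsUpTo617 = true := by
  decide +kernel

def stepsUpTo659 : List (ℕ × List Witness) := [
  (619, [⟨13619, 7693, 2078, 9667, 8710⟩, ⟨285979, 148731, 20779, 143657, 9172⟩, ⟨340451, 15449,
    269634, 305467, 300158⟩]),
  (631, [⟨55529, 41330, 42729, 5939, 37251⟩, ⟨138821, 56921, 98332, 113583, 1⟩, ⟨208231, 102334,
    51065, 169794, 107636⟩, ⟨263759, 60648, 3610, 122089, 209878⟩]),
  (641, [⟨338449, 135766, 76938, 144555, 17600⟩, ⟨408959, 640, 123233, 357886, 194145⟩, ⟨423061,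
    184339, 204015, 378112, 353369⟩, ⟨549979, 59694, 410695, 417191, 126118⟩]),
  (647, [⟨71171, 4376, 22267, 54445, 60877⟩, ⟨170809, 137008, 127922, 109327, 66616⟩, ⟨241979,
    86696, 151209, 161681, 203966⟩, ⟨284681, 217063, 25518, 23372, 141942⟩]),
  (659, [⟨304459, 21787, 91381, 50626, 73139⟩, ⟨376949, 147529, 8218, 115635, 2481⟩, ⟨507431,
    237437, 281641, 365580, 1⟩, ⟨521929, 207320, 220933, 386595, 60736⟩])]

theorem sieve_stepsUpTo659 :
    sieve 35595090494495708735551513774339790404327494231688708370638369570081510775836987394757169596642528583802601919462746958600907520736816715650879090093549160086607186640044350998256614021872413802722317829140833018825025279343256943476968875970600805985607171630607659200000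
      3799774592193278191163757074890189574287843563725493187919108404900723738788126198243672978394568913828043012818111179897086808275281689134284052187843520638029057704061299785600846191119851718578246765175347634798626355716008603998068264259308794788274275944799011738924754315998400000
      stepsUpTo659 = true := by
  decide +kernel

def stepsUpTo691 : List (ℕ × List Witness) := [
  (661, [⟨58169, 55326, 19504, 12380, 31843⟩, ⟨218131, 152017, 167402, 29476, 118145⟩, ⟨363551,
    63253, 256609, 290560, 52573⟩, ⟨785269, 352731, 188434, 338159, 583489⟩]),
  (673, [⟨148061, 142088, 30801, 98616, 111981⟩, ⟨444181, 350233, 201018, 318573, 13540⟩,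
    ⟨858749, 491696, 528206, 233474, 12002⟩, ⟨888361, 571589, 779566, 602374, 276685⟩]),
  (677, [⟨29789, 15535, 10313, 9662, 21783⟩, ⟨74471, 3398, 9705, 376, 1⟩, ⟨297881, 166792, 2114,
    66368, 101737⟩, ⟨402139, 190454, 198164, 122005, 334592⟩, ⟨670231, 214001, 139479, 296008,
    582508⟩]),
  (683, [⟨120209, 67879, 42816, 92400, 119098⟩, ⟨345599, 327973, 74560, 318905, 117469⟩,
    ⟨676171, 512390, 61884, 187421, 90412⟩, ⟨751301, 447362, 312458, 485146, 303082⟩]),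
  (691, [⟨288839, 275686, 196623, 109674, 109790⟩, ⟨456061, 421766, 115274, 48097, 282251⟩,
    ⟨684091, 508776, 187835, 312296, 407935⟩, ⟨820909, 650803, 35510, 107058, 10707⟩])]

theorem sieve_stepsUpTo691 :
    sieve 3799774592193278191163757074890189574287843563725493187919108404900723738788126198243672978394568913828043012818111179897086808275281689134284052187843520638029057704061299785600846191119851718578246765175347634798626355716008603998068264259308794788274275944799011738924754315998400000
      540084580013439421533723218620974044154417363329003028641216760676071578549559457565032974710590184189284427619307781556353452908408245370843254340074744521139984266099813187893038401738750135216507628703394412336303296221312479079119015698365010358922344881098164862596500404370826439186580971200000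
      stepsUpTo691 = true := by
  decide +kernel

def stepsUpTo701 : List (ℕ × List Witness) := [
  (701, [⟨138799, 72093, 58667, 99471, 13176⟩, ⟨215909, 146800, 173183, 133676, 188289⟩,
    ⟨231331, 180342, 228074, 85373, 136705⟩, ⟨909899, 311121, 168111, 184528, 1⟩])]

theorem sieve_stepsUpTo701 :
    sieve 540084580013439421533723218620974044154417363329003028641216760676071578549559457565032974710590184189284427619307781556353452908408245370843254340074744521139984266099813187893038401738750135216507628703394412336303296221312479079119015698365010358922344881098164862596500404370826439186580971200000
      378599290589421034495139976253302804952246571693631123077492949233926176563241179753088115272123719116688383761134754871003770488794180004961121292392395909319128970535969044713019919618863844786771847721079483047748610651140047834462430004553872261604563761649813568680146783463949333869793260811200000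
      stepsUpTo701 = true := by
  decide +kernel

theorem eq_zero_of_gibonacci_eq_pow {c : ℕ} (hc : c ∈ seeds) {m x : ℤ}
    (hm : m.natAbs ≤ 10 ^ 300 + 2) (h : gibonacci c m = x ^ 11) : m = 0 := by
  have h₀ : ((1 : ℕ) : ℤ) ∣ m := by simp
  have h₁ := dvd_of_sieve sieve_stepsUpTo2310 hc h h₀
  have h₂ := dvd_of_sieve sieve_stepsUpTo199 hc h h₁
  have h₃ := dvd_of_sieve sieve_stepsUpTo281 hc h h₂
  have h₄ := dvd_of_sieve sieve_stepsUpTo349 hc h h₃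
  have h₅ := dvd_of_sieve sieve_stepsUpTo401 hc h h₄
  have h₆ := dvd_of_sieve sieve_stepsUpTo449 hc h h₅
  have h₇ := dvd_of_sieve sieve_stepsUpTo491 hc h h₆
  have h₈ := dvd_of_sieve sieve_stepsUpTo541 hc h h₇
  have h₉ := dvd_of_sieve sieve_stepsUpTo577 hc h h₈
  have h₁₀ := dvd_of_sieve sieve_stepsUpTo617 hc h h₉
  have h₁₁ := dvd_of_sieve sieve_stepsUpTo659 hc h h₁₀
  have h₁₂ := dvd_of_sieve sieve_stepsUpTo691 hc h h₁₁
  have h₁₃ := dvd_of_sieve sieve_stepsUpTo701 hc h h₁₂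
  refine Int.eq_zero_of_dvd_of_natAbs_lt_natAbs h₁₃ (hm.trans_lt ?_)
  rw [Int.natAbs_natCast]
  decide +kernel

theorem lucasZ_eq (n : ℕ) : lucasZ n = 2 * Int.fib (n + 1) - Int.fib n := by
  induction n using Nat.twoStepInduction with
  | zero => rfl
  | one => rfl
  | more n ih₁ ih₂ =>
    rw [lucasZ, ih₁, ih₂]
    have h₁ := Int.fib_add_two n
    have h₂ := Int.fib_add_two (n + 1)
    rw [show (n : ℤ) + 1 + 2 = n + 2 + 1 by ring, show (n : ℤ) + 1 + 1 = n + 2 by ring] at h₂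
    push_cast
    rw [show (n : ℤ) + 1 + 1 = n + 2 by ring]
    linarith

/-- The integer-indexed sequence `a * uₙ + b * vₙ`. -/
def fibLucasComb (a b m : ℤ) : ℤ := a * Int.fib m + b * (2 * Int.fib (m + 1) - Int.fib m)

theorem fibLucasComb_natCast (a b : ℤ) (n : ℕ) :
    fibLucasComb a b n = a * fibZ n + b * lucasZ n := by
  rw [fibLucasComb, lucasZ_eq, fibZ, Int.fib_natCast]

theorem fibLucasComb_neg (a b m : ℤ) :
    fibLucasComb a (-b) m = fibLucasComb a b (-m) ∨
      fibLucasComb a (-b) m = -fibLucasComb a b (-m) := by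
  have h₁ := Int.fib_neg m
  have h₂ := Int.fib_neg (m - 1)
  have h₃ := Int.fib_add_two (m - 1)
  rw [show -(m - 1) = -m + 1 by ring] at h₂
  rw [show m - 1 + 2 = m + 1 by ring, show m - 1 + 1 = m by ring] at h₃
  simp only [fibLucasComb, h₁, h₂, h₃]
  by_cases h : Even m
  · have h' : ¬ Even (m - 1) := by rw [Int.even_sub]; simp [h]
    right
    rw [if_pos h, if_neg h']
    ring
  · have h' : Even (m - 1) := by rw [Int.even_sub]; simp [h]
    left
    rw [if_neg h, if_pos h']
    ring

theorem eq_one_or_neg_one_of_gibonacci_eq_pow {c : ℕ} (hc : c ∈ seeds) {m x : ℤ}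
    (hm : m.natAbs ≤ 10 ^ 300 + 2) (h : gibonacci c m = x ^ 11 ∨ gibonacci c m = -x ^ 11) :
    x = 1 ∨ x = -1 := by
  have hx : ∃ y : ℤ, (y = x ∨ y = -x) ∧ gibonacci c m = y ^ 11 := by
    rcases h with h | h
    · exact ⟨x, Or.inl rfl, h⟩
    · exact ⟨-x, Or.inr rfl, by rw [h, Odd.neg_pow (by decide)]⟩
  obtain ⟨y, hy, h⟩ := hx
  obtain rfl := eq_zero_of_gibonacci_eq_pow hc hm h
  have hy₁ : y ^ 11 = 1 := by simpa [gibonacci] using h.symm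
  have := Int.isUnit_iff.mp (IsUnit.of_pow_eq_one hy₁ (by norm_num))
  omega

theorem eq_one_or_neg_one_of_shift {a b k : ℤ} {c : ℕ} (hc : c ∈ seeds) (hk : k.natAbs ≤ 2)
    (hab : (∀ m, fibLucasComb a b m = gibonacci c (m + k)) ∨
      ∀ m, fibLucasComb a b m = -gibonacci c (m + k))
    {n : ℕ} (hn : n ≤ 10 ^ 300) {x : ℤ}
    (h : a * fibZ n + b * lucasZ n = x ^ 11 ∨ a * fibZ n + -b * lucasZ n = x ^ 11) :
    x = 1 ∨ x = -1 := by
  rw [← fibLucasComb_natCast, ← fibLucasComb_natCast] at h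
  have key : ∃ m : ℤ, m.natAbs ≤ n ∧
      (fibLucasComb a b m = x ^ 11 ∨ fibLucasComb a b m = -x ^ 11) := by
    rcases h with h | h
    · exact ⟨n, by simp, Or.inl h⟩
    · refine ⟨-n, by simp, ?_⟩
      rcases fibLucasComb_neg a b n with h' | h'
      · exact Or.inl (by rw [← h', h])
      · exact Or.inr (by rw [← h, h', neg_neg])
  obtain ⟨m, hm, h⟩ := key
  have hmk : (m + k).natAbs ≤ 10 ^ 300 + 2 :=
    (Int.natAbs_add_le m k).trans (add_le_add (hm.trans hn) hk)
  refine eq_one_or_neg_one_of_gibonacci_eq_pow hc hmk ?_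
  rcases hab with hab | hab
  · rwa [hab] at h
  · rw [hab] at h
    rcases h with h | h
    · exact Or.inr (by rw [← h, neg_neg])
    · exact Or.inl (neg_injective h)

theorem no_small_index_eleventh_powers (a b : ℤ)
    (hab : (a, b) ∈ ({(1, 2), (1, -2), (4, 1), (4, -1), (4, 3), (4, -3),
      (11, 4), (11, -4), (14, 5), (14, -5), (6, 5), (6, -5)} : Set (ℤ × ℤ)))
    (n : ℕ) (hn : n ≤ 10 ^ 300) (x : ℤ) (h : a * fibZ n + b * lucasZ n = x ^ 11) :
    x = 1 ∨ x = -1 := by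
  have rec₁ (m : ℤ) : Int.fib (m + 1) = Int.fib (m - 1) + Int.fib m := by
    have := Int.fib_add_two (m - 1)
    rwa [show m - 1 + 2 = m + 1 by ring, show m - 1 + 1 = m by ring] at this
  have rec₂ (m : ℤ) := Int.fib_add_two m
  have s₁ (m : ℤ) : fibLucasComb 1 (-2) m = -gibonacci (5 : ℕ) (m + -1) := by
    have h₁ := rec₁ (m - 1)
    rw [show m - 1 + 1 = m by ring] at h₁
    simp only [fibLucasComb, gibonacci, ← sub_eq_add_neg]
    push_cast
    linarith [rec₁ m]
  have s₂ (m : ℤ) : fibLucasComb 4 (-1) m = gibonacci (4 : ℕ) (m + -2) := by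
    have h₁ := rec₁ (m - 1)
    have h₂ := rec₁ (m - 2)
    rw [show m - 1 + 1 = m by ring, show m - 1 - 1 = m - 2 by ring] at h₁
    rw [show m - 2 + 1 = m - 1 by ring] at h₂
    simp only [fibLucasComb, gibonacci, ← sub_eq_add_neg]
    push_cast
    linarith [rec₁ m]
  have shift₁ (c m : ℤ) : gibonacci c (m + 1) = Int.fib m + c * Int.fib (m + 1) := by
    rw [gibonacci, add_sub_cancel_right]
  have shift₂ (c m : ℤ) :
      gibonacci c (m + 2) = Int.fib (m + 1) + c * (Int.fib m + Int.fib (m + 1)) := by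
    rw [gibonacci, rec₂, show m + 2 - 1 = m + 1 by ring]
  have s₃ (m : ℤ) : fibLucasComb 4 3 m = gibonacci (6 : ℕ) (m + 1) := by
    rw [shift₁, fibLucasComb]; push_cast; ring
  have s₄ (m : ℤ) : fibLucasComb 11 4 m = gibonacci (7 : ℕ) (m + 2) := by
    rw [shift₂, fibLucasComb]; push_cast; ring
  have s₅ (m : ℤ) : fibLucasComb 14 5 m = gibonacci (9 : ℕ) (m + 2) := by
    rw [shift₂, fibLucasComb]; push_cast; ring
  have s₆ (m : ℤ) : fibLucasComb 6 5 m = gibonacci (10 : ℕ) (m + 1) := by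
    rw [shift₁, fibLucasComb]; push_cast; ring
  simp only [Set.mem_insert_iff, Set.mem_singleton_iff, Prod.mk.injEq] at hab
  rcases hab with ⟨rfl, rfl⟩ | ⟨rfl, rfl⟩ | ⟨rfl, rfl⟩ | ⟨rfl, rfl⟩ | ⟨rfl, rfl⟩ | ⟨rfl, rfl⟩ |
    ⟨rfl, rfl⟩ | ⟨rfl, rfl⟩ | ⟨rfl, rfl⟩ | ⟨rfl, rfl⟩ | ⟨rfl, rfl⟩ | ⟨rfl, rfl⟩
  · exact eq_one_or_neg_one_of_shift (by decide) (by decide) (Or.inr s₁) hn (Or.inr h)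
  · exact eq_one_or_neg_one_of_shift (by decide) (by decide) (Or.inr s₁) hn (Or.inl h)
  · exact eq_one_or_neg_one_of_shift (by decide) (by decide) (Or.inl s₂) hn (Or.inr h)
  · exact eq_one_or_neg_one_of_shift (by decide) (by decide) (Or.inl s₂) hn (Or.inl h)
  · exact eq_one_or_neg_one_of_shift (by decide) (by decide) (Or.inl s₃) hn (Or.inl h)
  · exact eq_one_or_neg_one_of_shift (by decide) (by decide) (Or.inl s₃) hn (Or.inr h)
  · exact eq_one_or_neg_one_of_shift (by decide) (by decide) (Or.inl s₄) hn (Or.inl h)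
  · exact eq_one_or_neg_one_of_shift (by decide) (by decide) (Or.inl s₄) hn (Or.inr h)
  · exact eq_one_or_neg_one_of_shift (by decide) (by decide) (Or.inl s₅) hn (Or.inl h)
  · exact eq_one_or_neg_one_of_shift (by decide) (by decide) (Or.inl s₅) hn (Or.inr h)
  · exact eq_one_or_neg_one_of_shift (by decide) (by decide) (Or.inl s₆) hn (Or.inl h)
  · exact eq_one_or_neg_one_of_shift (by decide) (by decide) (Or.inl s₆) hn (Or.inr h)
end
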